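/- arXiv:0904.1641 — 2 statements merged into one kernel-verified Lean document; each statement's English description precedes it below -/
import Mathlib

section
/- Let k be a real number with k < 1, and let ρ₁ ∈ (0,1) satisfy u(ρ₁) = 1/2. Then ∫_0^{ρ₁} f(-q^5)^{5-6k} · f(-q)^{6k-1} · q^{-k} dq = ∫_{1/2}^∞ x^{k-1} / √(125 + 22x + x²) dx, both improper integrals being convergent. -/
open MeasureTheory Real

/-- Euler's product `f(-q) = ∏_{n=1}^∞ (1 - qⁿ)`. -/
noncomputable def eulerF (q : ℝ) : ℝ := ∏' n : ℕ, (1 - q ^ (n + 1))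

/-- `u(q) = f(-q)⁶ / (q · f(-q⁵)⁶)`. -/
noncomputable def uF (q : ℝ) : ℝ := eulerF q ^ 6 / (q * eulerF (q ^ 5) ^ 6)

namespace LevelFive

open UpperHalfPlane ModularForm EisensteinSeries CongruenceSubgroup Matrix.SpecialLinearGroup
open scoped MatrixGroups Manifold ModularForm

/-- Multiplication by `5` on the upper half plane. -/
noncomputable def five (τ : ℍ) : ℍ := ⟨5 * τ, by simpa using τ.im_pos⟩

@[simp] lemma coe_five (τ : ℍ) : (five τ : ℂ) = 5 * τ := rfl

@[simp] lemma im_five (τ : ℍ) : (five τ).im = 5 * τ.im := by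
  rw [← coe_im, coe_five]; simp

lemma five_surjective : Function.Surjective five := fun τ ↦
  ⟨⟨τ / 5, by simpa using τ.im_pos⟩, by ext; simp [mul_div_cancel₀]⟩

lemma mdifferentiable_comp_five {f : ℍ → ℂ} (hf : MDiff f) : MDiff (fun τ ↦ f (five τ)) := by
  rw [UpperHalfPlane.mdifferentiable_iff] at hf ⊢
  have hmaps : Set.MapsTo (fun z : ℂ ↦ 5 * z) {z | 0 < z.im} {z | 0 < z.im} := fun z hz ↦ by
    simpa using hz
  refine (hf.comp (f := fun z : ℂ ↦ 5 * z) (by fun_prop) hmaps).congr fun z hz ↦ ?_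
  simp only [Function.comp_apply]
  congr 1
  ext
  rw [coe_five, ofComplex_apply_of_im_pos hz, ofComplex_apply_of_im_pos (hmaps hz)]

/-- The conjugate of an element of `Γ₀(5)` by multiplication by `5`. -/
lemma exists_five_smul {γ : SL(2, ℤ)} (hγ : γ ∈ Gamma0 5) :
    ∃ γ' : SL(2, ℤ), 5 * γ' 1 0 = γ 1 0 ∧ ∀ τ : ℍ, five (γ • τ) = γ' • five τ ∧
      denom γ' (five τ) = denom γ τ := by
  rw [Gamma0_mem, ZMod.intCast_zmod_eq_zero_iff_dvd] at hγ
  obtain ⟨c, hc⟩ := hγ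
  have hc : γ 1 0 = 5 * c := by simpa using hc
  have hdet := γ.det_coe
  rw [Matrix.det_fin_two] at hdet
  obtain ⟨γ', hγ'⟩ : ∃ g : SL(2, ℤ),
      (g : Matrix (Fin 2) (Fin 2) ℤ) = !![γ 0 0, 5 * γ 0 1; c, γ 1 1] :=
    ⟨⟨_, by rw [Matrix.det_fin_two_of]; rw [hc] at hdet; linarith⟩, rfl⟩
  have h00 : γ' 0 0 = γ 0 0 := by simp [hγ']
  have h01 : γ' 0 1 = 5 * γ 0 1 := by simp [hγ']
  have h10 : γ' 1 0 = c := by simp [hγ']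
  have h11 : γ' 1 1 = γ 1 1 := by simp [hγ']
  refine ⟨γ', by rw [h10, hc], fun τ ↦ ⟨?_, ?_⟩⟩
  · ext
    rw [coe_five, coe_specialLinearGroup_apply, coe_specialLinearGroup_apply, h00, h01, h10, h11,
      hc, coe_five]
    push_cast
    simp
    ring
  · simp [denom, hc, h10, h11]; ring

lemma E2_smul (γ : SL(2, ℤ)) (τ : ℍ) :
    E2 (γ • τ) = denom γ τ ^ 2 * (E2 τ - 1 / (2 * riemannZeta 2) * D2 γ τ) := by
  have h := congrFun (E2_slash_action γ) τ
  rw [SL_slash_def] at h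
  simp only [Pi.sub_apply, Pi.smul_apply, smul_eq_mul] at h
  rw [← h]
  have := denom_ne_zero γ τ
  rw [zpow_neg]
  field_simp

lemma E₄_smul (γ : SL(2, ℤ)) (τ : ℍ) : E₄ (γ • τ) = denom γ τ ^ 4 * E₄ τ := by
  have hγ : (γ : GL (Fin 2) ℝ) ∈ 𝒮ℒ := ⟨γ, rfl⟩
  have := SlashInvariantForm.slash_action_eqn'' E₄ hγ τ
  exact_mod_cast this

lemma discriminant_smul (γ : SL(2, ℤ)) (τ : ℍ) :
    discriminant (γ • τ) = denom γ τ ^ 12 * discriminant τ := by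
  have hγ : (γ : GL (Fin 2) ℝ) ∈ 𝒮ℒ := ⟨γ, rfl⟩
  have := SlashInvariantForm.slash_action_eqn'' CuspForm.discriminant hγ τ
  exact_mod_cast this

/-- The Eisenstein series of weight two and level `Γ₀(5)`. -/
noncomputable def eis (τ : ℍ) : ℂ := (5 * E2 (five τ) - E2 τ) / 4

lemma eis_smul {γ : SL(2, ℤ)} (hγ : γ ∈ Gamma0 5) (τ : ℍ) :
    eis (γ • τ) = denom γ τ ^ 2 * eis τ := by
  obtain ⟨γ', h10, h⟩ := exists_five_smul hγ
  obtain ⟨h1, h2⟩ := h τ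
  rw [eis, eis, h1, E2_smul, E2_smul, h2, D2, D2, h2, ← h10]
  push_cast
  ring

lemma coe_S_smul (τ : ℍ) : ((ModularGroup.S • τ : ℍ) : ℂ) = -1 / τ := by
  rw [modular_S_smul]; simp [neg_div]

lemma five_S_smul_five (τ : ℍ) : five (ModularGroup.S • five τ) = ModularGroup.S • τ := by
  ext
  rw [coe_five, coe_S_smul, coe_S_smul, coe_five]
  have := τ.ne_zero
  field_simp

lemma E2_S_smul (τ : ℍ) :
    E2 (ModularGroup.S • τ) = τ ^ 2 * E2 τ - τ / (2 * riemannZeta 2) * (2 * π * Complex.I) := by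
  have := τ.ne_zero
  rw [E2_smul, ModularGroup.denom_S, D2_S]
  field_simp

lemma eis_S_smul_five (τ : ℍ) : eis (ModularGroup.S • five τ) = -5 * τ ^ 2 * eis τ := by
  rw [eis, eis, five_S_smul_five, E2_S_smul, E2_S_smul, coe_five]
  ring

lemma E₄_S_smul (τ : ℍ) : E₄ (ModularGroup.S • τ) = τ ^ 4 * E₄ τ := by
  rw [E₄_smul, ModularGroup.denom_S]

lemma discriminant_S_smul (τ : ℍ) :
    discriminant (ModularGroup.S • τ) = τ ^ 12 * discriminant τ := by
  rw [discriminant_smul, ModularGroup.denom_S]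

/-- Every element of `SL(2, ℤ)` lies in `Γ₀(5)` or in `Γ₀(5) S T ^ j` for some `j`. -/
lemma mem_Gamma0_five_or (γ : SL(2, ℤ)) :
    γ ∈ Gamma0 5 ∨ ∃ δ ∈ Gamma0 5, ∃ j : ℤ, γ = δ * ModularGroup.S * ModularGroup.T ^ j := by
  by_cases h : γ ∈ Gamma0 5
  · exact .inl h
  · right
    have : Fact (Nat.Prime 5) := ⟨by norm_num⟩
    rw [Gamma0_mem] at h
    obtain ⟨j, hj⟩ := ZMod.intCast_surjective ((γ 1 1 : ZMod 5) / (γ 1 0 : ZMod 5))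
    obtain ⟨g, hg⟩ : ∃ g : SL(2, ℤ), (g : Matrix (Fin 2) (Fin 2) ℤ) = !![j, 1; -1, 0] :=
      ⟨⟨_, by simp⟩, rfl⟩
    have hgS : g * (ModularGroup.S * ModularGroup.T ^ j) = 1 := by
      ext a b
      rw [Matrix.SpecialLinearGroup.coe_mul, Matrix.SpecialLinearGroup.coe_mul,
        ModularGroup.coe_T_zpow, ModularGroup.coe_S, hg]
      fin_cases a <;> fin_cases b <;> simp [Matrix.mul_apply, Fin.sum_univ_two]
    refine ⟨γ * g, ?_, j, by rw [mul_assoc, mul_assoc, hgS, mul_one]⟩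
    rw [Gamma0_mem, Matrix.SpecialLinearGroup.coe_mul, Matrix.mul_apply, Fin.sum_univ_two]
    simp only [hg]
    simp [hj]
    field_simp
    simp

/-- A holomorphic `Γ₀(5)`-invariant function bounded at both cusps is constant. -/
lemma eq_const_of_Gamma0_five {f g : ℍ → ℂ} (hf : MDiff f)
    (hinv : ∀ γ ∈ Gamma0 5, ∀ τ : ℍ, f (γ • τ) = f τ) (hbdd : IsBoundedAtImInfty f)
    (hS : ∀ τ, f (ModularGroup.S • five τ) = g τ) (hg : IsBoundedAtImInfty g) (τ τ' : ℍ) :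
    f τ = f τ' := by
  have hfS : IsBoundedAtImInfty (fun τ ↦ f (ModularGroup.S • τ)) := by
    rw [isBoundedAtImInfty_iff] at hg ⊢
    obtain ⟨M, A, h⟩ := hg
    refine ⟨M, 5 * A, fun z hz ↦ ?_⟩
    obtain ⟨z, rfl⟩ := five_surjective z
    rw [hS]
    rw [im_five] at hz
    exact h z (by linarith)
  let F : ModularForm ((Gamma0 5).map (mapGL ℝ)) 0 :=
    { toFun := f
      slash_action_eq' := by
        rintro _ ⟨γ, hγ, rfl⟩
        ext τ
        change (f ∣[(0 : ℤ)] γ) τ = _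
        rw [SL_slash_def]
        simpa using hinv γ hγ τ
      holo' := hf
      bdd_at_cusps' := by
        intro c hc
        rw [Subgroup.IsArithmetic.isCusp_iff_isCusp_SL2Z] at hc
        rw [OnePoint.isBoundedAt_iff_forall_SL2Z hc]
        intro γ _
        rw [SL_slash_def]
        simp only [neg_zero, zpow_zero, mul_one]
        rcases mem_Gamma0_five_or γ with h | ⟨δ, hδ, j, rfl⟩
        · simpa only [hinv γ h] using hbdd
        · simp only [mul_smul, hinv δ hδ]
          rw [isBoundedAtImInfty_iff] at hfS ⊢
          obtain ⟨M, A, h⟩ := hfS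
          refine ⟨M, A, fun z hz ↦ h _ ?_⟩
          rw [modular_T_zpow_smul]
          simpa using hz }
  obtain ⟨c, hc⟩ := ModularForm.eq_const_of_weight_zero F
  have hc' : f = Function.const ℍ c := hc
  rw [hc']; rfl

/-- Weight four form vanishing to order `2` at the cusp `0`. -/
noncomputable def formA (τ : ℍ) : ℂ :=
  (19 * E₄ τ - 500 * eis τ ^ 2 + 625 * E₄ (five τ)) / 144

/-- Weight four form vanishing to order `1` at both cusps. -/
noncomputable def formB (τ : ℍ) : ℂ := -(E₄ τ - 26 * eis τ ^ 2 + 25 * E₄ (five τ)) / 72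

/-- Weight four form vanishing to order `2` at the cusp `∞`. -/
noncomputable def formC (τ : ℍ) : ℂ := (E₄ τ - 20 * eis τ ^ 2 + 19 * E₄ (five τ)) / 720

lemma eis_sq (τ : ℍ) : eis τ ^ 2 = formA τ + 22 * formB τ + 125 * formC τ := by
  rw [formA, formB, formC]; ring

lemma E₄_five_smul {γ : SL(2, ℤ)} (hγ : γ ∈ Gamma0 5) (τ : ℍ) :
    E₄ (five (γ • τ)) = denom γ τ ^ 4 * E₄ (five τ) := by
  obtain ⟨γ', -, h⟩ := exists_five_smul hγ
  rw [(h τ).1, E₄_smul, (h τ).2]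

lemma discriminant_five_smul {γ : SL(2, ℤ)} (hγ : γ ∈ Gamma0 5) (τ : ℍ) :
    discriminant (five (γ • τ)) = denom γ τ ^ 12 * discriminant (five τ) := by
  obtain ⟨γ', -, h⟩ := exists_five_smul hγ
  rw [(h τ).1, discriminant_smul, (h τ).2]

lemma formA_smul {γ : SL(2, ℤ)} (hγ : γ ∈ Gamma0 5) (τ : ℍ) :
    formA (γ • τ) = denom γ τ ^ 4 * formA τ := by
  rw [formA, formA, E₄_five_smul hγ, E₄_smul, eis_smul hγ]; ring

lemma formB_smul {γ : SL(2, ℤ)} (hγ : γ ∈ Gamma0 5) (τ : ℍ) :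
    formB (γ • τ) = denom γ τ ^ 4 * formB τ := by
  rw [formB, formB, E₄_five_smul hγ, E₄_smul, eis_smul hγ]; ring

lemma formA_S_smul_five (τ : ℍ) :
    formA (ModularGroup.S • five τ) = 3125 * τ ^ 4 * formC τ := by
  rw [formA, formC, five_S_smul_five, E₄_S_smul, E₄_S_smul, eis_S_smul_five, coe_five]; ring

lemma formB_S_smul_five (τ : ℍ) :
    formB (ModularGroup.S • five τ) = 25 * τ ^ 4 * formB τ := by
  rw [formB, formB, five_S_smul_five, E₄_S_smul, E₄_S_smul, eis_S_smul_five, coe_five]; ring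

lemma mdifferentiable_discriminant : MDiff discriminant := CuspForm.discriminant.holo'

lemma mdifferentiable_E₄ : MDiff (E₄ : ℍ → ℂ) := E₄.holo'

lemma mdifferentiable_eis : MDiff eis := by
  have h1 := E2_mdifferentiable
  have h2 := mdifferentiable_comp_five h1
  rw [UpperHalfPlane.mdifferentiable_iff] at h1 h2 ⊢
  exact (((h2.const_mul 5).sub h1).div_const 4).congr fun z _ ↦ rfl

lemma mdifferentiable_formA : MDiff formA := by
  have h1 := mdifferentiable_E₄
  have h2 := mdifferentiable_comp_five h1
  have h3 := mdifferentiable_eis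
  rw [UpperHalfPlane.mdifferentiable_iff] at h1 h2 h3 ⊢
  exact ((((h1.const_mul 19).sub ((h3.pow 2).const_mul 500)).add (h2.const_mul 625)).div_const
    144).congr fun z _ ↦ rfl

lemma mdifferentiable_formB : MDiff formB := by
  have h1 := mdifferentiable_E₄
  have h2 := mdifferentiable_comp_five h1
  have h3 := mdifferentiable_eis
  rw [UpperHalfPlane.mdifferentiable_iff] at h1 h2 h3 ⊢
  exact (((h1.sub ((h3.pow 2).const_mul 26)).add (h2.const_mul 25)).neg.div_const
    72).congr fun z _ ↦ rfl

/-- The quotient of `formA ^ 12` by the corresponding eta quotient. -/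
noncomputable def quotA (τ : ℍ) : ℂ :=
  formA τ ^ 12 * discriminant (five τ) / discriminant τ ^ 5

/-- The quotient of `formB ^ 6` by the corresponding eta quotient. -/
noncomputable def quotB (τ : ℍ) : ℂ := formB τ ^ 6 / (discriminant τ * discriminant (five τ))

/-- The quotient of `formC ^ 12` by the corresponding eta quotient. -/
noncomputable def quotC (τ : ℍ) : ℂ :=
  formC τ ^ 12 * discriminant τ / discriminant (five τ) ^ 5

lemma quotA_S_smul_five (τ : ℍ) : quotA (ModularGroup.S • five τ) = quotC τ := by
  have h1 := discriminant_ne_zero τ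
  have h2 := discriminant_ne_zero (five τ)
  have h3 := τ.ne_zero
  rw [quotA, quotC, five_S_smul_five, formA_S_smul_five, discriminant_S_smul,
    discriminant_S_smul, coe_five]
  field_simp
  ring

lemma quotB_S_smul_five (τ : ℍ) : quotB (ModularGroup.S • five τ) = quotB τ := by
  have h1 := discriminant_ne_zero τ
  have h2 := discriminant_ne_zero (five τ)
  have h3 := τ.ne_zero
  rw [quotB, quotB, five_S_smul_five, formB_S_smul_five, discriminant_S_smul,
    discriminant_S_smul, coe_five]
  field_simp
  ring

lemma mdifferentiable_quotA : MDiff quotA := by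
  have h1 := mdifferentiable_discriminant
  have h2 := mdifferentiable_comp_five h1
  have h3 := mdifferentiable_formA
  rw [UpperHalfPlane.mdifferentiable_iff] at h1 h2 h3 ⊢
  exact (((h3.pow 12).mul h2).div (h1.pow 5)
    fun z _ ↦ pow_ne_zero 5 (discriminant_ne_zero _)).congr fun z _ ↦ rfl

lemma mdifferentiable_quotB : MDiff quotB := by
  have h1 := mdifferentiable_discriminant
  have h2 := mdifferentiable_comp_five h1
  have h3 := mdifferentiable_formB
  rw [UpperHalfPlane.mdifferentiable_iff] at h1 h2 h3 ⊢
  exact ((h3.pow 6).div (h1.mul h2)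
    fun z _ ↦ mul_ne_zero (discriminant_ne_zero _) (discriminant_ne_zero _)).congr fun z _ ↦ rfl

lemma quotA_smul {γ : SL(2, ℤ)} (hγ : γ ∈ Gamma0 5) (τ : ℍ) : quotA (γ • τ) = quotA τ := by
  have h1 := discriminant_ne_zero τ
  have h2 := denom_ne_zero γ τ
  rw [quotA, quotA, formA_smul hγ, discriminant_smul, discriminant_five_smul hγ]
  field_simp

lemma quotB_smul {γ : SL(2, ℤ)} (hγ : γ ∈ Gamma0 5) (τ : ℍ) : quotB (γ • τ) = quotB τ := by
  have h1 := discriminant_ne_zero τ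
  have h3 := discriminant_ne_zero (five τ)
  have h2 := denom_ne_zero γ τ
  rw [quotB, quotB, formB_smul hγ, discriminant_smul, discriminant_five_smul hγ]
  field_simp

open Filter Topology

/-- The nome `exp (2 π i τ)`. -/
noncomputable def nome (τ : ℍ) : ℂ := Function.Periodic.qParam 1 τ

lemma nome_eq (τ : ℍ) : nome τ = Complex.exp (2 * π * Complex.I * τ) := by
  simp [nome, Function.Periodic.qParam]

lemma nome_ne_zero (τ : ℍ) : nome τ ≠ 0 := Function.Periodic.qParam_ne_zero _

lemma tendsto_nome : Tendsto nome atImInfty (𝓝 0) := qParam_tendsto_atImInfty one_pos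

lemma nome_five (τ : ℍ) : nome (five τ) = nome τ ^ 5 := by
  rw [nome_eq, nome_eq, ← Complex.exp_nat_mul, coe_five]
  congr 1
  push_cast; ring

lemma tendsto_five : Tendsto five atImInfty atImInfty := by
  rw [atImInfty, tendsto_comap_iff]
  have : (UpperHalfPlane.im ∘ five) = fun τ ↦ 5 * UpperHalfPlane.im τ := by ext; simp
  rw [this]
  exact tendsto_comap.const_mul_atTop (by norm_num)

/-- The remainder of a `q`-expansion after its linear part is `q ^ 2` times a bounded function. -/
lemma exists_bounded_remainder {F : ℍ → ℂ} {c : ℕ → ℂ}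
    (hF : ∀ τ, HasSum (fun n ↦ c n * nome τ ^ n) (F τ)) :
    ∃ X : ℍ → ℂ, IsBoundedAtImInfty X ∧ ∀ τ, F τ = c 0 + c 1 * nome τ + nome τ ^ 2 * X τ := by
  refine ⟨fun τ ↦ (F τ - (c 0 + c 1 * nome τ)) / nome τ ^ 2, ?_, fun τ ↦ ?_⟩
  · refine isBoundedAtImInfty_of_hasSum_qExpansion (c := fun n ↦ c (n + 2)) one_pos fun τ ↦ ?_
    have h := ((hasSum_nat_add_iff' 2).mpr (hF τ)).div_const (nome τ ^ 2)
    have hq := nome_ne_zero τ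
    simp only [Finset.sum_range_succ, Finset.sum_range_zero, zero_add, pow_zero, mul_one,
      pow_one] at h
    convert! h using 2 with n
    rw [pow_add, smul_eq_mul, ← mul_assoc, mul_div_assoc, div_self (pow_ne_zero 2 hq), mul_one]
    rfl
  · have hq := nome_ne_zero τ
    field_simp
    ring

lemma exists_E2_eq : ∃ X : ℍ → ℂ, IsBoundedAtImInfty X ∧
    ∀ τ, E2 τ = 1 - 24 * nome τ + nome τ ^ 2 * X τ := by
  obtain ⟨X, hX, h⟩ := exists_bounded_remainder (F := E2) fun τ ↦ by
    simpa only [nome_eq, smul_eq_mul] using hasSum_qExpansion_E2 (z := τ)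
  exact ⟨X, hX, fun τ ↦ by rw [h]; simp; ring⟩

lemma exists_E₄_eq : ∃ X : ℍ → ℂ, IsBoundedAtImInfty X ∧
    ∀ τ, E₄ τ = 1 + 240 * nome τ + nome τ ^ 2 * X τ := by
  obtain ⟨X, hX, h⟩ := exists_bounded_remainder (F := E₄) fun τ ↦
    ModularForm.hasSum_qExpansion (f := E₄) one_pos one_mem_strictPeriods_SL τ
  exact ⟨X, hX, fun τ ↦ by rw [h, E₄_qExpansion_coeff_one, E_qExpansion_coeff_zero _ ⟨2, rfl⟩]⟩

lemma exists_discriminant_eq : ∃ Y : ℍ → ℂ, Tendsto Y atImInfty (𝓝 1) ∧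
    ∀ τ, discriminant τ = nome τ * Y τ :=
  ⟨_, tendsto_atImInfty_tprod_one_sub_eta_q_pow, discriminant_eq_q_prod⟩

lemma IsBoundedAtImInfty.comp_five {X : ℍ → ℂ} (hX : IsBoundedAtImInfty X) :
    IsBoundedAtImInfty (fun τ ↦ X (five τ)) := hX.comp_tendsto tendsto_five

lemma exists_eis_eq : ∃ Z : ℍ → ℂ, IsBoundedAtImInfty Z ∧
    ∀ τ, eis τ = 1 + 6 * nome τ + nome τ ^ 2 * Z τ := by
  obtain ⟨X, hX, h⟩ := exists_E2_eq
  let x : boundedFilterSubalgebra ℂ atImInfty := ⟨X, hX⟩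
  let x' : boundedFilterSubalgebra ℂ atImInfty := ⟨_, IsBoundedAtImInfty.comp_five hX⟩
  let q : boundedFilterSubalgebra ℂ atImInfty := ⟨nome, tendsto_nome.isBigO_one ℝ⟩
  refine ⟨_, ((1 / 4 : ℂ) • (5 * (-24 * q ^ 3 + q ^ 8 * x') - x)).2, fun τ ↦ ?_⟩
  have : eis τ = 1 + 6 * nome τ + nome τ ^ 2 *
      ((1 / 4 : ℂ) * (5 * (-24 * nome τ ^ 3 + nome τ ^ 8 * X (five τ)) - X τ)) := by
    rw [eis, h, h, nome_five]; ring
  exact this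

lemma tendsto_mul_of_bounded {X : ℍ → ℂ} (hX : IsBoundedAtImInfty X) :
    Tendsto (fun τ ↦ nome τ * X τ) atImInfty (𝓝 0) :=
  ZeroAtFilter.mul_boundedAtFilter tendsto_nome hX

lemma exists_formA_eq : ∃ R : ℍ → ℂ, IsBoundedAtImInfty R ∧
    ∀ τ, formA τ = 1 + nome τ * R τ := by
  obtain ⟨Z, hZ, hE⟩ := exists_eis_eq
  obtain ⟨V, hV, hF⟩ := exists_E₄_eq
  let v : boundedFilterSubalgebra ℂ atImInfty := ⟨V, hV⟩
  let v' : boundedFilterSubalgebra ℂ atImInfty := ⟨_, IsBoundedAtImInfty.comp_five hV⟩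
  let z : boundedFilterSubalgebra ℂ atImInfty := ⟨Z, hZ⟩
  let q : boundedFilterSubalgebra ℂ atImInfty := ⟨nome, tendsto_nome.isBigO_one ℝ⟩
  refine ⟨_, ((1 / 144 : ℂ) • (19 * (240 + q * v) - 500 * ((6 + q * z) * (2 + 6 * q + q ^ 2 * z)) +
    625 * (240 * q ^ 4 + q ^ 9 * v'))).2, fun τ ↦ ?_⟩
  have : formA τ = 1 + nome τ * ((1 / 144 : ℂ) * (19 * (240 + nome τ * V τ) -
      500 * ((6 + nome τ * Z τ) * (2 + 6 * nome τ + nome τ ^ 2 * Z τ)) +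
      625 * (240 * nome τ ^ 4 + nome τ ^ 9 * V (five τ)))) := by
    rw [formA, hE, hF, hF, nome_five]; ring
  exact this

lemma exists_formB_eq : ∃ R : ℍ → ℂ, IsBoundedAtImInfty R ∧
    ∀ τ, formB τ = nome τ * (1 + nome τ * R τ) := by
  obtain ⟨Z, hZ, hE⟩ := exists_eis_eq
  obtain ⟨V, hV, hF⟩ := exists_E₄_eq
  let v : boundedFilterSubalgebra ℂ atImInfty := ⟨V, hV⟩
  let v' : boundedFilterSubalgebra ℂ atImInfty := ⟨_, IsBoundedAtImInfty.comp_five hV⟩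
  let z : boundedFilterSubalgebra ℂ atImInfty := ⟨Z, hZ⟩
  let q : boundedFilterSubalgebra ℂ atImInfty := ⟨nome, tendsto_nome.isBigO_one ℝ⟩
  refine ⟨_, ((-1 / 72 : ℂ) • (v - 26 * (36 + 2 * z + 12 * q * z + q ^ 2 * z ^ 2) +
    25 * (240 * q ^ 3 + q ^ 8 * v'))).2, fun τ ↦ ?_⟩
  have : formB τ = nome τ * (1 + nome τ * ((-1 / 72 : ℂ) * (V τ -
      26 * (36 + 2 * Z τ + 12 * nome τ * Z τ + nome τ ^ 2 * Z τ ^ 2) +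
      25 * (240 * nome τ ^ 3 + nome τ ^ 8 * V (five τ))))) := by
    rw [formB, hE, hF, hF, nome_five]; ring
  exact this

lemma exists_formC_eq : ∃ R : ℍ → ℂ, IsBoundedAtImInfty R ∧
    ∀ τ, formC τ = nome τ ^ 2 * R τ := by
  obtain ⟨Z, hZ, hE⟩ := exists_eis_eq
  obtain ⟨V, hV, hF⟩ := exists_E₄_eq
  let v : boundedFilterSubalgebra ℂ atImInfty := ⟨V, hV⟩
  let v' : boundedFilterSubalgebra ℂ atImInfty := ⟨_, IsBoundedAtImInfty.comp_five hV⟩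
  let z : boundedFilterSubalgebra ℂ atImInfty := ⟨Z, hZ⟩
  let q : boundedFilterSubalgebra ℂ atImInfty := ⟨nome, tendsto_nome.isBigO_one ℝ⟩
  refine ⟨_, ((1 / 720 : ℂ) • (v - 20 * (36 + 2 * z + 12 * q * z + q ^ 2 * z ^ 2) +
    19 * (240 * q ^ 3 + q ^ 8 * v'))).2, fun τ ↦ ?_⟩
  have : formC τ = nome τ ^ 2 * ((1 / 720 : ℂ) * (V τ -
      20 * (36 + 2 * Z τ + 12 * nome τ * Z τ + nome τ ^ 2 * Z τ ^ 2) +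
      19 * (240 * nome τ ^ 3 + nome τ ^ 8 * V (five τ)))) := by
    rw [formC, hE, hF, hF, nome_five]; ring
  exact this

lemma tendsto_quotA : Tendsto quotA atImInfty (𝓝 1) := by
  obtain ⟨R, hR, h⟩ := exists_formA_eq
  obtain ⟨Y, hY, hD⟩ := exists_discriminant_eq
  have hlim := (((tendsto_mul_of_bounded hR).const_add 1).pow 12).mul
    ((hY.comp tendsto_five).div (hY.pow 5) (by simp))
  norm_num at hlim
  refine hlim.congr fun τ ↦ ?_
  have hq := nome_ne_zero τ
  rw [quotA, h, hD, hD, nome_five, mul_pow, mul_div_assoc, mul_div_mul_left _ _ (pow_ne_zero 5 hq)]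

lemma tendsto_quotB : Tendsto quotB atImInfty (𝓝 1) := by
  obtain ⟨R, hR, h⟩ := exists_formB_eq
  obtain ⟨Y, hY, hD⟩ := exists_discriminant_eq
  have hlim := (((tendsto_mul_of_bounded hR).const_add 1).pow 6).div
    (hY.mul (hY.comp tendsto_five)) (by simp)
  norm_num at hlim
  refine hlim.congr fun τ ↦ ?_
  have hq := nome_ne_zero τ
  rw [quotB, h, hD, hD, nome_five, mul_pow, show nome τ * Y τ * (nome τ ^ 5 * Y (five τ)) =
    nome τ ^ 6 * (Y τ * Y (five τ)) by ring, mul_div_mul_left _ _ (pow_ne_zero 6 hq)]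
  rfl

lemma isBoundedAtImInfty_quotC : IsBoundedAtImInfty quotC := by
  obtain ⟨R, hR, h⟩ := exists_formC_eq
  obtain ⟨Y, hY, hD⟩ := exists_discriminant_eq
  have hlim := hY.div ((hY.comp tendsto_five).pow 5) (by simp)
  let r : boundedFilterSubalgebra ℂ atImInfty := ⟨R, hR⟩
  let y : boundedFilterSubalgebra ℂ atImInfty := ⟨_, hlim.isBigO_one ℝ⟩
  have hb := (r ^ 12 * y).2
  have heq : quotC = fun τ ↦ R τ ^ 12 * (Y τ / Y (five τ) ^ 5) := by
    ext τ
    have hq := nome_ne_zero τ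
    rw [quotC, h, hD, hD, nome_five, show (nome τ ^ 2 * R τ) ^ 12 * (nome τ * Y τ) =
      nome τ ^ 25 * (R τ ^ 12 * Y τ) by ring, show (nome τ ^ 5 * Y (five τ)) ^ 5 =
      nome τ ^ 25 * Y (five τ) ^ 5 by ring, mul_div_mul_left _ _ (pow_ne_zero 25 hq),
      mul_div_assoc]
  rw [heq]
  exact hb

lemma eq_of_const_of_tendsto {f : ℍ → ℂ} {c : ℂ} (hf : ∀ τ τ', f τ = f τ')
    (hc : Tendsto f atImInfty (𝓝 c)) (τ : ℍ) : f τ = c :=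
  tendsto_nhds_unique (tendsto_const_nhds.congr fun τ' ↦ hf τ τ') hc

lemma quotA_eq_one (τ : ℍ) : quotA τ = 1 :=
  eq_of_const_of_tendsto (eq_const_of_Gamma0_five mdifferentiable_quotA
    (fun _ hγ ↦ quotA_smul hγ) (tendsto_quotA.isBigO_one ℝ) quotA_S_smul_five
    isBoundedAtImInfty_quotC) tendsto_quotA τ

lemma quotB_eq_one (τ : ℍ) : quotB τ = 1 :=
  eq_of_const_of_tendsto (eq_const_of_Gamma0_five mdifferentiable_quotB
    (fun _ hγ ↦ quotB_smul hγ) (tendsto_quotB.isBigO_one ℝ) quotB_S_smul_five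
    (tendsto_quotB.isBigO_one ℝ)) tendsto_quotB τ

lemma quotC_eq_one (τ : ℍ) : quotC τ = 1 := by
  rw [← quotA_S_smul_five, quotA_eq_one]

/-- The point `i t` of the upper half plane, for `t > 0`. -/
noncomputable def axis (t : ℝ) : ℍ := ofComplex (Complex.I * t)

lemma coe_axis {t : ℝ} (ht : 0 < t) : (axis t : ℂ) = Complex.I * t := by
  rw [axis, ofComplex_apply_of_im_pos (by simpa using ht)]

lemma im_axis {t : ℝ} (ht : 0 < t) : (axis t).im = t := by
  rw [← coe_im, coe_axis ht]; simp

lemma five_axis {t : ℝ} (ht : 0 < t) : five (axis t) = axis (5 * t) := by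
  ext
  rw [coe_five, coe_axis ht, coe_axis (by positivity)]
  push_cast; ring

lemma S_smul_five_axis {t : ℝ} (ht : 0 < t) :
    ModularGroup.S • five (axis t) = axis (1 / (5 * t)) := by
  ext
  rw [coe_S_smul, coe_five, coe_axis ht, coe_axis (by positivity)]
  have : (t : ℂ) ≠ 0 := by exact_mod_cast ht.ne'
  have := Complex.I_ne_zero
  push_cast
  field_simp
  simp

lemma nome_axis {t : ℝ} (ht : 0 < t) : nome (axis t) = (Real.exp (-2 * π * t) : ℝ) := by
  rw [nome_eq, coe_axis ht]
  push_cast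
  congr 1
  linear_combination (2 * π * t : ℂ) * Complex.I_sq

lemma tendsto_axis : Tendsto axis atTop atImInfty := by
  rw [atImInfty, tendsto_comap_iff]
  exact tendsto_id.congr' ((eventually_gt_atTop 0).mono fun t ht ↦ (im_axis ht).symm)

lemma continuousOn_comp_axis {F : ℍ → ℂ} (hF : MDiff F) :
    ContinuousOn (fun t ↦ F (axis t)) (Set.Ioi 0) := by
  rw [UpperHalfPlane.mdifferentiable_iff] at hF
  exact hF.continuousOn.comp (f := fun t : ℝ ↦ Complex.I * t) (by fun_prop)
    fun t ht ↦ by simpa using ht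

open scoped ComplexConjugate

lemma conj_eq_of_hasSum {F : ℂ} {c : ℕ → ℂ} {q : ℝ} (hF : HasSum (fun n ↦ c n * (q : ℂ) ^ n) F)
    (hc : ∀ n, conj (c n) = c n) : conj F = F := by
  have h := hF.map (starRingEnd ℂ) Complex.continuous_conj
  refine h.unique ?_
  convert! hF using 2 with n
  simp [hc]

lemma conj_E2_axis {t : ℝ} (ht : 0 < t) : conj (E2 (axis t)) = E2 (axis t) := by
  have h := hasSum_qExpansion_E2 (z := axis t)
  simp only [← nome_eq, nome_axis ht, smul_eq_mul] at h
  exact conj_eq_of_hasSum h fun n ↦ by split_ifs <;> simp [map_ofNat]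

lemma conj_E₄_axis {t : ℝ} (ht : 0 < t) : conj (E₄ (axis t)) = E₄ (axis t) := by
  have h := ModularForm.hasSum_qExpansion (f := E₄) one_pos one_mem_strictPeriods_SL (axis t)
  change HasSum (fun m ↦ _ * nome (axis t) ^ m) _ at h
  simp only [nome_axis ht] at h
  exact conj_eq_of_hasSum h fun n ↦ by
    rw [E_qExpansion_coeff _ ⟨2, rfl⟩]
    split_ifs <;> simp [map_ofNat]

lemma conj_eis_axis {t : ℝ} (ht : 0 < t) : conj (eis (axis t)) = eis (axis t) := by
  simp [eis, map_ofNat, five_axis ht, conj_E2_axis ht, conj_E2_axis (show 0 < 5 * t by positivity)]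

lemma conj_formA_axis {t : ℝ} (ht : 0 < t) : conj (formA (axis t)) = formA (axis t) := by
  simp [formA, map_ofNat, five_axis ht, conj_eis_axis ht, conj_E₄_axis ht,
    conj_E₄_axis (show 0 < 5 * t by positivity)]

lemma conj_formB_axis {t : ℝ} (ht : 0 < t) : conj (formB (axis t)) = formB (axis t) := by
  simp [formB, map_ofNat, five_axis ht, conj_eis_axis ht, conj_E₄_axis ht,
    conj_E₄_axis (show 0 < 5 * t by positivity)]

lemma conj_formC_axis {t : ℝ} (ht : 0 < t) : conj (formC (axis t)) = formC (axis t) := by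
  simp [formC, map_ofNat, five_axis ht, conj_eis_axis ht, conj_E₄_axis ht,
    conj_E₄_axis (show 0 < 5 * t by positivity)]

/-- Euler's product as a function of a complex variable. -/
noncomputable def eulerP (w : ℂ) : ℂ := ∏' n : ℕ, (1 - w ^ (n + 1))

lemma multipliable_euler {q : ℝ} (hq : q ∈ Set.Ioo (0 : ℝ) 1) :
    Multipliable fun n : ℕ ↦ 1 - q ^ (n + 1) := by
  simp_rw [sub_eq_add_neg]
  apply Real.multipliable_one_add_of_summable
  simpa using ((summable_nat_add_iff 1).mpr
    (summable_geometric_of_lt_one hq.1.le hq.2)).neg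

lemma ofReal_eulerF {q : ℝ} (hq : q ∈ Set.Ioo (0 : ℝ) 1) : (eulerF q : ℂ) = eulerP q := by
  have h := (multipliable_euler hq).map_tprod Complex.ofRealHom Complex.continuous_ofReal
  rw [eulerP, eulerF]
  simpa using h

lemma eulerF_pos {q : ℝ} (hq : q ∈ Set.Ioo (0 : ℝ) 1) : 0 < eulerF q := by
  refine lt_of_le_of_ne ?_ (Ne.symm ?_)
  · refine ge_of_tendsto' (multipliable_euler hq).hasProd fun s ↦ Finset.prod_nonneg fun n _ ↦ ?_
    linarith [pow_le_one₀ (n := n + 1) hq.1.le hq.2.le]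
  · have h := tprod_one_add_ne_zero_of_summable (f := fun n : ℕ ↦ -(q : ℝ) ^ (n + 1))
      (fun n ↦ by
        have := pow_lt_one₀ hq.1.le hq.2 (n := n + 1) (by simp)
        linarith)
      (by simpa [abs_of_pos hq.1] using ((summable_nat_add_iff 1).mpr
        (summable_geometric_of_lt_one hq.1.le hq.2)))
    simpa [← sub_eq_add_neg, eulerF] using h

lemma pow_five_mem {q : ℝ} (hq : q ∈ Set.Ioo (0 : ℝ) 1) : q ^ 5 ∈ Set.Ioo (0 : ℝ) 1 :=
  ⟨by have := hq.1; positivity, pow_lt_one₀ hq.1.le hq.2 (by norm_num)⟩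

lemma discriminant_eq (τ : ℍ) : discriminant τ = nome τ * eulerP (nome τ) ^ 24 := by
  rw [discriminant_eq_q_prod, ((multipliableLocallyUniformlyOn_eta.multipliable τ.2).tprod_pow _)]
  rfl

lemma exp_neg_mem {t : ℝ} (ht : 0 < t) : Real.exp (-2 * π * t) ∈ Set.Ioo (0 : ℝ) 1 :=
  ⟨Real.exp_pos _, by rw [Real.exp_lt_one_iff]; have := Real.pi_pos; nlinarith [mul_pos this ht]⟩

lemma discriminant_axis {t q : ℝ} (ht : 0 < t) (hq : q = Real.exp (-2 * π * t)) :
    discriminant (axis t) = (q * eulerF q ^ 24 : ℝ) := by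
  have h := ofReal_eulerF (exp_neg_mem ht)
  rw [discriminant_eq, nome_axis ht, ← h, hq]
  push_cast; rfl

lemma differentiableOn_eulerP : DifferentiableOn ℂ eulerP (Metric.ball 0 1) :=
  differentiableOn_tprod_one_sub_pow

lemma nome_mem_ball (τ : ℍ) : nome τ ∈ Metric.ball (0 : ℂ) 1 := by
  simpa [nome] using norm_qParam_lt_one 1 τ

lemma eulerP_nome_ne_zero (τ : ℍ) : eulerP (nome τ) ≠ 0 := eta_tprod_ne_zero τ.2

/-- The logarithmic derivative of Euler's product in terms of `E₂`. -/
lemma deriv_eulerP_nome (τ : ℍ) :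
    24 * (nome τ * deriv eulerP (nome τ)) = (E2 τ - 1) * eulerP (nome τ) := by
  have h := logDeriv_eta_eq_E2 τ
  have hP : DifferentiableAt ℂ eulerP (nome τ) :=
    differentiableOn_eulerP.differentiableAt (Metric.isOpen_ball.mem_nhds (nome_mem_ball τ))
  have hP' : DifferentiableAt ℂ (fun z ↦ ∏' n, (1 - eta_q n z)) (τ : ℂ) :=
    differentiableAt_eta_tprod τ.2
  have hq : DifferentiableAt ℂ (Function.Periodic.qParam 1) (τ : ℂ) := by fun_prop
  have hcomp : (fun z ↦ ∏' n, (1 - eta_q n z)) = eulerP ∘ Function.Periodic.qParam 1 := rfl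
  unfold eta at h
  rw [logDeriv_mul _ (Function.Periodic.qParam_ne_zero _) (eta_tprod_ne_zero τ.2) (by fun_prop) hP',
    logDeriv_qParam, hcomp, logDeriv_comp (by exact hP) hq] at h
  have h1 := logDeriv_qParam 1 τ
  rw [logDeriv_apply, div_eq_iff (Function.Periodic.qParam_ne_zero _)] at h1
  rw [h1, logDeriv_apply] at h
  change _ + deriv eulerP (nome τ) / eulerP (nome τ) * (_ * nome τ) = _ at h
  have h0 := eulerP_nome_ne_zero τ
  have hpi : (π : ℂ) ≠ 0 := by exact_mod_cast Real.pi_ne_zero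
  have hI := Complex.I_ne_zero
  field_simp at h
  push_cast at h
  linear_combination h / 24

/-- Relation between the derivative of `eulerF` and `E₂` on the imaginary axis. -/
lemma hasDerivAt_eulerF {t q : ℝ} (ht : 0 < t) (hq : q = Real.exp (-2 * π * t)) :
    HasDerivAt eulerF (eulerF q * ((E2 (axis t)).re - 1) / (24 * q)) q := by
  have hmem : q ∈ Set.Ioo (0 : ℝ) 1 := hq ▸ exp_neg_mem ht
  have hn : nome (axis t) = q := by rw [nome_axis ht, hq]
  have hP : DifferentiableAt ℂ eulerP (q : ℂ) := hn ▸
    differentiableOn_eulerP.differentiableAt (Metric.isOpen_ball.mem_nhds (nome_mem_ball _))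
  have h := hP.hasDerivAt.real_of_complex
  have hd := deriv_eulerP_nome (axis t)
  rw [hn, ← ofReal_eulerF hmem, ← Complex.conj_eq_iff_re.mp (conj_E2_axis ht)] at hd
  have hd' := congrArg Complex.re hd
  have hq0 := hmem.1.ne'
  have hval : (deriv eulerP (q : ℂ)).re = eulerF q * ((E2 (axis t)).re - 1) / (24 * q) := by
    rw [eq_div_iff (by positivity)]
    norm_num [Complex.mul_re, Complex.mul_im] at hd'
    linarith
  rw [hval] at h
  refine h.congr_of_eventuallyEq ?_
  filter_upwards [Ioo_mem_nhds hmem.1 hmem.2] with x hx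
  rw [← ofReal_eulerF hx, Complex.ofReal_re]

lemma hasDerivAt_uF {t q : ℝ} (ht : 0 < t) (hq : q = Real.exp (-2 * π * t)) :
    HasDerivAt uF (-(uF q * (eis (axis t)).re / q)) q := by
  have hmem : q ∈ Set.Ioo (0 : ℝ) 1 := hq ▸ exp_neg_mem ht
  have h1 := hasDerivAt_eulerF ht hq
  have hq5 : q ^ 5 = Real.exp (-2 * π * (5 * t)) := by
    rw [hq, ← Real.exp_nat_mul]; congr 1; push_cast; ring
  have h5 := HasDerivAt.comp (h₂ := eulerF) (h := fun x : ℝ ↦ x ^ 5) q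
    (hasDerivAt_eulerF (show 0 < 5 * t by positivity) hq5) (hasDerivAt_pow 5 q)
  have hP := (eulerF_pos hmem).ne'
  have hQ := (eulerF_pos (pow_five_mem hmem)).ne'
  have hq0 := hmem.1.ne'
  have h := (h1.pow 6).div ((hasDerivAt_id q).mul (h5.pow 6)) (by
    simp [hq0, hQ])
  refine h.congr_deriv ?_
  have he : (eis (axis t)).re = (5 * (E2 (axis (5 * t))).re - (E2 (axis t)).re) / 4 := by
    rw [eis, five_axis ht]
    simp
  rw [he, uF]
  simp only [Pi.pow_apply, Pi.mul_apply, Function.comp_apply, id]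
  field_simp
  push_cast
  ring

lemma eqOn_of_pow_eq {f g : ℝ → ℝ} {n : ℕ} (hn : n ≠ 0) (hf : ContinuousOn f (Set.Ioi 0))
    (hg : ContinuousOn g (Set.Ioi 0)) (hpow : ∀ t > 0, f t ^ n = g t ^ n) (hpos : ∀ t > 0, 0 < g t)
    {y : ℝ} (hy : 0 < y) (hy' : 0 < f y) {t : ℝ} (ht : 0 < t) : f t = g t := by
  have hsq : Set.EqOn (f ^ 2) (g ^ 2) (Set.Ioi 0) := fun t ht ↦ by
    have h : |f t| ^ n = |g t| ^ n := by rw [← abs_pow, ← abs_pow, hpow t ht]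
    have := (pow_left_inj₀ (abs_nonneg _) (abs_nonneg _) hn).mp h
    simpa using (sq_eq_sq_iff_abs_eq_abs _ _).mpr this
  refine isPreconnected_Ioi.eq_of_sq_eq hf hg hsq (fun hx ↦ (hpos _ hx).ne') hy ?_ ht
  exact (pow_left_inj₀ hy'.le (hpos y hy).le hn).mp (hpow y hy)

lemma continuousOn_re_comp_axis {F : ℍ → ℂ} (hF : MDiff F) :
    ContinuousOn (fun t ↦ (F (axis t)).re) (Set.Ioi 0) :=
  Complex.continuous_re.comp_continuousOn (continuousOn_comp_axis hF)

lemma continuousOn_eulerF_exp :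
    ContinuousOn (fun t ↦ eulerF (Real.exp (-2 * π * t))) (Set.Ioi 0) := fun t ht ↦
  (ContinuousAt.comp (f := fun t : ℝ ↦ Real.exp (-2 * π * t)) (g := eulerF)
    (hasDerivAt_eulerF (t := t) ht rfl).continuousAt
    (by fun_prop)).continuousWithinAt

lemma continuousOn_eulerF_exp_pow :
    ContinuousOn (fun t ↦ eulerF (Real.exp (-2 * π * t) ^ 5)) (Set.Ioi 0) := by
  have h := continuousOn_eulerF_exp.comp (f := fun t : ℝ ↦ 5 * t) (s := Set.Ioi 0)
    (by fun_prop) (fun t ht ↦ by simpa using ht)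
  refine h.congr fun t _ ↦ ?_
  simp only [Function.comp_apply]
  rw [← Real.exp_nat_mul]
  congr 2; push_cast; ring

lemma exists_formA_axis_pos : ∃ y > 0, 0 < (formA (axis y)).re := by
  obtain ⟨R, hR, h⟩ := exists_formA_eq
  have hlim : Tendsto formA atImInfty (𝓝 1) := by
    have := (tendsto_mul_of_bounded hR).const_add 1
    rw [add_zero] at this
    exact this.congr fun τ ↦ (h τ).symm
  have h1 := (Complex.continuous_re.tendsto 1).comp (hlim.comp tendsto_axis)
  have h2 := h1.eventually (lt_mem_nhds (show (0 : ℝ) < (1 : ℂ).re by simp))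
  obtain ⟨y, hy, hy0⟩ := (h2.and (eventually_gt_atTop 0)).exists
  exact ⟨y, hy0, hy⟩

lemma exists_formB_axis_pos : ∃ y > 0, 0 < (formB (axis y)).re := by
  obtain ⟨R, hR, h⟩ := exists_formB_eq
  have hlim : Tendsto (fun τ ↦ 1 + nome τ * R τ) atImInfty (𝓝 1) := by
    have := (tendsto_mul_of_bounded hR).const_add 1
    rwa [add_zero] at this
  have h1 := (Complex.continuous_re.tendsto 1).comp (hlim.comp tendsto_axis)
  have h2 := h1.eventually (lt_mem_nhds (show (0 : ℝ) < (1 : ℂ).re by simp))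
  obtain ⟨y, hy, hy0⟩ := (h2.and (eventually_gt_atTop 0)).exists
  refine ⟨y, hy0, ?_⟩
  rw [h, nome_axis hy0, Complex.re_ofReal_mul]
  exact mul_pos (Real.exp_pos _) (by simpa [nome_axis hy0] using hy)

lemma exists_eis_axis_pos : ∃ y > 0, 0 < (eis (axis y)).re := by
  obtain ⟨Z, hZ, h⟩ := exists_eis_eq
  have hlim : Tendsto eis atImInfty (𝓝 1) := by
    have := (tendsto_nome.const_mul 6).const_add 1 |>.add
      (tendsto_nome.mul (tendsto_mul_of_bounded hZ))
    norm_num at this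
    exact this.congr fun τ ↦ by rw [h]; ring
  have h1 := (Complex.continuous_re.tendsto 1).comp (hlim.comp tendsto_axis)
  have h2 := h1.eventually (lt_mem_nhds (show (0 : ℝ) < (1 : ℂ).re by simp))
  obtain ⟨y, hy, hy0⟩ := (h2.and (eventually_gt_atTop 0)).exists
  exact ⟨y, hy0, hy⟩

lemma exp_pow_five (t : ℝ) : Real.exp (-2 * π * t) ^ 5 = Real.exp (-2 * π * (5 * t)) := by
  rw [← Real.exp_nat_mul]; congr 1; push_cast; ring

lemma discriminant_five_axis {t q : ℝ} (ht : 0 < t) (hq : q = Real.exp (-2 * π * t)) :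
    discriminant (five (axis t)) = (q ^ 5 * eulerF (q ^ 5) ^ 24 : ℝ) := by
  rw [five_axis ht, discriminant_axis (by positivity) (q := q ^ 5) (by rw [hq, exp_pow_five])]

lemma formA_axis {t q : ℝ} (ht : 0 < t) (hq : q = Real.exp (-2 * π * t)) :
    (formA (axis t)).re = eulerF q ^ 10 / eulerF (q ^ 5) ^ 2 := by
  subst hq
  obtain ⟨y, hy, hy'⟩ := exists_formA_axis_pos
  have hP {t : ℝ} (ht : t > 0) := eulerF_pos (exp_neg_mem ht)
  have hQ {t : ℝ} (ht : t > 0) := eulerF_pos (pow_five_mem (exp_neg_mem ht))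
  refine eqOn_of_pow_eq (f := fun t ↦ (formA (axis t)).re) (g := fun t ↦
    eulerF (Real.exp (-2 * π * t)) ^ 10 / eulerF (Real.exp (-2 * π * t) ^ 5) ^ 2)
    (n := 12) (by norm_num) (continuousOn_re_comp_axis mdifferentiable_formA)
    ((continuousOn_eulerF_exp.pow 10).div (continuousOn_eulerF_exp_pow.pow 2) fun t ht ↦
      (pow_pos (hQ ht) 2).ne') (fun t ht ↦ ?_)
    (fun t ht ↦ div_pos (pow_pos (hP ht) _) (pow_pos (hQ ht) _)) hy hy' ht
  have h := quotA_eq_one (axis t)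
  rw [quotA, discriminant_axis ht rfl, discriminant_five_axis ht rfl,
    ← Complex.conj_eq_iff_re.mp (conj_formA_axis ht)] at h
  simp only [← Complex.ofReal_pow, ← Complex.ofReal_mul, ← Complex.ofReal_div,
    Complex.ofReal_eq_one] at h
  have h1 := (hP ht).ne'
  have h2 := (hQ ht).ne'
  have h3 := (Real.exp_pos (-2 * π * t)).ne'
  generalize Real.exp (-2 * π * t) = q at *
  field_simp at h ⊢
  linarith

lemma formB_axis {t q : ℝ} (ht : 0 < t) (hq : q = Real.exp (-2 * π * t)) :
    (formB (axis t)).re = q * eulerF q ^ 4 * eulerF (q ^ 5) ^ 4 := by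
  subst hq
  obtain ⟨y, hy, hy'⟩ := exists_formB_axis_pos
  have hP {t : ℝ} (ht : t > 0) := eulerF_pos (exp_neg_mem ht)
  have hQ {t : ℝ} (ht : t > 0) := eulerF_pos (pow_five_mem (exp_neg_mem ht))
  refine eqOn_of_pow_eq (f := fun t ↦ (formB (axis t)).re) (g := fun t ↦ Real.exp (-2 * π * t) *
    eulerF (Real.exp (-2 * π * t)) ^ 4 * eulerF (Real.exp (-2 * π * t) ^ 5) ^ 4)
    (n := 6) (by norm_num) (continuousOn_re_comp_axis mdifferentiable_formB)
    (((by fun_prop : Continuous fun t : ℝ ↦ Real.exp (-2 * π * t)).continuousOn.mul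
      (continuousOn_eulerF_exp.pow 4)).mul (continuousOn_eulerF_exp_pow.pow 4))
    (fun t ht ↦ ?_) (fun t ht ↦ mul_pos (mul_pos (Real.exp_pos _) (pow_pos (hP ht) _))
      (pow_pos (hQ ht) _)) hy hy' ht
  have h := quotB_eq_one (axis t)
  rw [quotB, discriminant_axis ht rfl, discriminant_five_axis ht rfl,
    ← Complex.conj_eq_iff_re.mp (conj_formB_axis ht)] at h
  simp only [← Complex.ofReal_pow, ← Complex.ofReal_mul, ← Complex.ofReal_div,
    Complex.ofReal_eq_one] at h
  have h1 := (hP ht).ne'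
  have h2 := (hQ ht).ne'
  have h3 := (Real.exp_pos (-2 * π * t)).ne'
  generalize Real.exp (-2 * π * t) = q at *
  rw [div_eq_one_iff_eq (by positivity)] at h
  simp only [h]
  ring

lemma formC_axis {t q : ℝ} (ht : 0 < t) (hq : q = Real.exp (-2 * π * t)) :
    (formC (axis t)).re = q ^ 2 * eulerF (q ^ 5) ^ 10 / eulerF q ^ 2 := by
  have hpos : 0 < (formC (axis t)).re := by
    have h := formA_S_smul_five (axis t)
    rw [S_smul_five_axis ht, coe_axis ht, ← Complex.conj_eq_iff_re.mp (conj_formC_axis ht),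
      ← Complex.conj_eq_iff_re.mp (conj_formA_axis (by positivity)), mul_pow, Complex.I_pow_four, one_mul,
      formA_axis (by positivity) rfl] at h
    simp only [← Complex.ofReal_pow, ← Complex.ofReal_mul, ← Complex.ofReal_ofNat,
      Complex.ofReal_inj] at h
    have hm := exp_neg_mem (show 0 < 1 / (5 * t) by positivity)
    have h0 : 0 < 3125 * t ^ 4 * (formC (axis t)).re := by
      rw [← h]
      exact div_pos (pow_pos (eulerF_pos hm) _) (pow_pos (eulerF_pos (pow_five_mem hm)) _)
    exact pos_of_mul_pos_right h0 (by positivity)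
  have hm : q ∈ Set.Ioo (0 : ℝ) 1 := hq ▸ exp_neg_mem ht
  have hP := eulerF_pos hm
  have hQ := eulerF_pos (pow_five_mem hm)
  have hq0 := hm.1
  have h := quotC_eq_one (axis t)
  rw [quotC, discriminant_axis ht hq, discriminant_five_axis ht hq,
    ← Complex.conj_eq_iff_re.mp (conj_formC_axis ht)] at h
  simp only [← Complex.ofReal_pow, ← Complex.ofReal_mul, ← Complex.ofReal_div,
    Complex.ofReal_eq_one] at h
  refine (pow_left_inj₀ hpos.le (by positivity) (show 12 ≠ 0 by norm_num)).mp ?_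
  field_simp at h ⊢
  linarith

/-- Ramanujan's formula for the level five Eisenstein series of weight two. -/
lemma eis_axis {t q : ℝ} (ht : 0 < t) (hq : q = Real.exp (-2 * π * t)) :
    (eis (axis t)).re =
      q * eulerF (q ^ 5) ^ 5 / eulerF q * √(125 + 22 * uF q + uF q ^ 2) := by
  have key {t : ℝ} (ht : 0 < t) : (eis (axis t)).re ^ 2 =
      (formA (axis t)).re + 22 * (formB (axis t)).re + 125 * (formC (axis t)).re := by
    have h := eis_sq (axis t)
    rw [← Complex.conj_eq_iff_re.mp (conj_eis_axis ht),
      ← Complex.conj_eq_iff_re.mp (conj_formA_axis ht),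
      ← Complex.conj_eq_iff_re.mp (conj_formB_axis ht),
      ← Complex.conj_eq_iff_re.mp (conj_formC_axis ht)] at h
    exact_mod_cast h
  have hpos {t : ℝ} (ht : 0 < t) :
      0 < (formA (axis t)).re + 22 * (formB (axis t)).re + 125 * (formC (axis t)).re := by
    have hm := exp_neg_mem ht
    have hP := eulerF_pos hm
    have hQ := eulerF_pos (pow_five_mem hm)
    have hq0 := hm.1
    rw [formA_axis ht rfl, formB_axis ht rfl, formC_axis ht rfl]
    positivity
  obtain ⟨y, hy, hy'⟩ := exists_eis_axis_pos
  have hC : MDiff formC := by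
    have h1 := mdifferentiable_E₄
    have h2 := mdifferentiable_comp_five h1
    have h3 := mdifferentiable_eis
    rw [UpperHalfPlane.mdifferentiable_iff] at h1 h2 h3 ⊢
    exact (((h1.sub ((h3.pow 2).const_mul 20)).add (h2.const_mul 19)).div_const
      720).congr fun z _ ↦ rfl
  have h1 := eqOn_of_pow_eq (f := fun t ↦ (eis (axis t)).re) (g := fun t ↦ √((formA (axis t)).re +
    22 * (formB (axis t)).re + 125 * (formC (axis t)).re)) (n := 2) (by norm_num)
    (continuousOn_re_comp_axis mdifferentiable_eis)
    (((continuousOn_re_comp_axis mdifferentiable_formA).add ((continuousOn_re_comp_axis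
      mdifferentiable_formB).const_smul (22 : ℝ))).add ((continuousOn_re_comp_axis hC).const_smul
        (125 : ℝ))).sqrt
    (fun t ht ↦ by simp only [Real.sq_sqrt (hpos ht).le, key ht])
    (fun t ht ↦ Real.sqrt_pos.mpr (hpos ht)) hy hy' ht
  have hm : q ∈ Set.Ioo (0 : ℝ) 1 := hq ▸ exp_neg_mem ht
  have hP := eulerF_pos hm
  have hQ := eulerF_pos (pow_five_mem hm)
  have hq0 := hm.1
  have h2 : 0 ≤ q * eulerF (q ^ 5) ^ 5 / eulerF q := by positivity
  rw [← Real.sqrt_sq h2, ← Real.sqrt_mul (sq_nonneg _)]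
  refine h1.trans ?_
  simp only [formA_axis ht hq, formB_axis ht hq, formC_axis ht hq, uF]
  congr 1
  field_simp
  ring

lemma hasDerivAt_uF_sqrt {q : ℝ} (hq : q ∈ Set.Ioo (0 : ℝ) 1) :
    HasDerivAt uF (-(eulerF q ^ 5 / (q * eulerF (q ^ 5)) * √(125 + 22 * uF q + uF q ^ 2))) q := by
  have hlog : Real.log q < 0 := Real.log_neg hq.1 hq.2
  have hpi := Real.pi_pos
  have ht : 0 < -Real.log q / (2 * π) := by
    apply div_pos <;> linarith
  have hqt : q = Real.exp (-2 * π * (-Real.log q / (2 * π))) := by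
    rw [show -2 * π * (-Real.log q / (2 * π)) = Real.log q by field_simp, Real.exp_log hq.1]
  refine (hasDerivAt_uF ht hqt).congr_deriv ?_
  rw [eis_axis ht hqt]
  have hP := (eulerF_pos hq).ne'
  have hQ := (eulerF_pos (pow_five_mem hq)).ne'
  have hq0 := hq.1.ne'
  generalize √(125 + 22 * uF q + uF q ^ 2) = s
  rw [uF]
  field_simp

lemma uF_pos {q : ℝ} (hq : q ∈ Set.Ioo (0 : ℝ) 1) : 0 < uF q := by
  have hP := eulerF_pos hq
  have hQ := eulerF_pos (pow_five_mem hq)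
  have hq0 := hq.1
  rw [uF]
  positivity

lemma strictAntiOn_uF : StrictAntiOn uF (Set.Ioo 0 1) := by
  refine strictAntiOn_of_deriv_neg (convex_Ioo 0 1)
    (fun q hq ↦ (hasDerivAt_uF_sqrt hq).continuousAt.continuousWithinAt) fun q hq ↦ ?_
  rw [interior_Ioo] at hq
  rw [(hasDerivAt_uF_sqrt hq).deriv, neg_lt_zero]
  have hP := eulerF_pos hq
  have hQ := eulerF_pos (pow_five_mem hq)
  have hq0 := hq.1
  have hu := uF_pos hq
  positivity

lemma tendsto_eulerF : Tendsto eulerF (𝓝[>] 0) (𝓝 1) := by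
  have h0 : eulerP 0 = 1 := by simp [eulerP]
  have h : ContinuousAt eulerP ((0 : ℝ) : ℂ) := (differentiableOn_eulerP.differentiableAt
    (Metric.isOpen_ball.mem_nhds (by simp))).continuousAt
  have h1 := (Complex.continuous_re.continuousAt.comp
    (h.comp Complex.continuous_ofReal.continuousAt)).tendsto.mono_left
      (nhdsWithin_le_nhds (s := Set.Ioi (0 : ℝ)))
  simp only [Function.comp_apply, Complex.ofReal_zero, h0, Complex.one_re] at h1
  refine h1.congr' ?_
  filter_upwards [Ioo_mem_nhdsGT (show (0 : ℝ) < 1 by norm_num)] with q hq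
  simp [← ofReal_eulerF hq]

lemma tendsto_uF : Tendsto uF (𝓝[>] 0) atTop := by
  have h5 : Tendsto (fun q : ℝ ↦ q ^ 5) (𝓝[>] 0) (𝓝[>] 0) := by
    refine tendsto_nhdsWithin_iff.mpr ⟨?_, ?_⟩
    · have : Continuous fun q : ℝ ↦ q ^ 5 := by fun_prop
      simpa using (this.tendsto 0).mono_left nhdsWithin_le_nhds
    · filter_upwards [self_mem_nhdsWithin] with q hq using pow_pos (Set.mem_Ioi.mp hq) 5
  have h := (tendsto_eulerF.pow 6).div ((tendsto_eulerF.comp h5).pow 6) (by simp)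
  refine (h.pos_mul_atTop (by simp) tendsto_inv_nhdsGT_zero).congr fun q ↦ ?_
  simp only [Function.comp_apply, uF, Pi.div_apply]
  rw [div_mul_eq_div_div_swap, div_eq_mul_inv _ q]

lemma image_uF {ρ : ℝ} (hρ : ρ ∈ Set.Ioo (0 : ℝ) 1) :
    uF '' Set.Ioo 0 ρ = Set.Ioi (uF ρ) := by
  apply Set.Subset.antisymm
  · rintro _ ⟨q, hq, rfl⟩
    exact strictAntiOn_uF ⟨hq.1, hq.2.trans hρ.2⟩ hρ hq.2
  · intro x hx
    obtain ⟨a, ha, ha'⟩ := ((tendsto_uF.eventually_gt_atTop x).and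
      (Ioo_mem_nhdsGT hρ.1)).exists
    have hcont : ContinuousOn uF (Set.Icc a ρ) := fun q hq ↦ (hasDerivAt_uF_sqrt
      ⟨ha'.1.trans_le hq.1, hq.2.trans_lt hρ.2⟩).continuousAt.continuousWithinAt
    obtain ⟨q, hq, rfl⟩ := intermediate_value_Ioo' ha'.2.le hcont ⟨hx, ha⟩
    exact ⟨q, ⟨ha'.1.trans hq.1, hq.2⟩, rfl⟩

lemma integrand_eq {q : ℝ} (hq : q ∈ Set.Ioo (0 : ℝ) 1) (k : ℝ) :
    |-(eulerF q ^ 5 / (q * eulerF (q ^ 5)) * √(125 + 22 * uF q + uF q ^ 2))| •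
        (uF q ^ (k - 1) / √(125 + 22 * uF q + uF q ^ 2)) =
      eulerF (q ^ 5) ^ (5 - 6 * k) * eulerF q ^ (6 * k - 1) * q ^ (-k) := by
  have hP := eulerF_pos hq
  have hQ := eulerF_pos (pow_five_mem hq)
  have hq0 := hq.1
  have hu := uF_pos hq
  have hs : 0 < √(125 + 22 * uF q + uF q ^ 2) := by positivity
  rw [abs_neg, abs_of_pos (by positivity), smul_eq_mul, mul_assoc, mul_div_cancel₀ _ hs.ne', uF]
  generalize eulerF q = P at *
  generalize eulerF (q ^ 5) = Q at *
  rw [Real.div_rpow (by positivity) (by positivity), Real.mul_rpow (by positivity) (by positivity),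
    ← Real.rpow_natCast_mul hP.le, ← Real.rpow_natCast_mul hQ.le,
    show Q ^ (5 - 6 * k) = Q ^ (-1 : ℝ) * Q ^ (-((6 : ℕ) * (k - 1))) by
      rw [← Real.rpow_add hQ]; congr 1; push_cast; ring,
    show P ^ (6 * k - 1) = P ^ ((5 : ℕ) : ℝ) * P ^ ((6 : ℕ) * (k - 1)) by
      rw [← Real.rpow_add hP]; congr 1; push_cast; ring,
    show q ^ (-k) = q ^ (-1 : ℝ) * q ^ (-(k - 1)) by
      rw [← Real.rpow_add hq0]; congr 1; ring,
    Real.rpow_neg hQ.le, Real.rpow_neg hQ.le, Real.rpow_neg hq0.le, Real.rpow_neg hq0.le,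
    Real.rpow_one, Real.rpow_one, Real.rpow_natCast]
  field_simp

lemma integrableOn_rpow_div_sqrt {k : ℝ} (hk : k < 1) {a : ℝ} (ha : 0 < a) :
    IntegrableOn (fun x : ℝ ↦ x ^ (k - 1) / √(125 + 22 * x + x ^ 2)) (Set.Ioi a) := by
  have hbase : IntegrableOn (fun x : ℝ ↦ x ^ (k - 2)) (Set.Ioi a) :=
    integrableOn_Ioi_rpow_of_lt (by linarith) ha
  refine hbase.mono' ?_ ?_
  · refine ContinuousOn.aestronglyMeasurable (fun x hx ↦ ?_) measurableSet_Ioi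
    have hx0 : 0 < x := ha.trans hx
    refine (ContinuousAt.div (Real.continuousAt_rpow_const _ _ (Or.inl hx0.ne'))
      (by fun_prop) ?_).continuousWithinAt
    positivity
  · refine (ae_restrict_iff' measurableSet_Ioi).mpr (Eventually.of_forall fun x hx ↦ ?_)
    have hx0 : 0 < x := ha.trans hx
    rw [Real.norm_of_nonneg (by positivity), show k - 2 = k - 1 - 1 by ring,
      Real.rpow_sub_one hx0.ne' (k - 1)]
    exact div_le_div_of_nonneg_left (by positivity) hx0 (Real.le_sqrt_of_sq_le (by nlinarith))

end LevelFive

theorem integral_fk_rho1 (k : ℝ) (hk : k < 1) (ρ₁ : ℝ) (hρ : ρ₁ ∈ Set.Ioo (0 : ℝ) 1)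
    (huρ : uF ρ₁ = 1 / 2) :
    IntervalIntegrable
        (fun q => eulerF (q ^ 5) ^ (5 - 6 * k) * eulerF q ^ (6 * k - 1) * q ^ (-k))
        volume 0 ρ₁ ∧
      IntegrableOn (fun x => x ^ (k - 1) / Real.sqrt (125 + 22 * x + x ^ 2))
        (Set.Ioi (1 / 2 : ℝ)) ∧
      ∫ q in (0:ℝ)..ρ₁,
          eulerF (q ^ 5) ^ (5 - 6 * k) * eulerF q ^ (6 * k - 1) * q ^ (-k) =
        ∫ x in Set.Ioi (1 / 2 : ℝ), x ^ (k - 1) / Real.sqrt (125 + 22 * x + x ^ 2) := by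
  have hsub : Set.Ioo 0 ρ₁ ⊆ Set.Ioo (0 : ℝ) 1 := Set.Ioo_subset_Ioo_right hρ.2.le
  have hderiv : ∀ q ∈ Set.Ioo 0 ρ₁, HasDerivWithinAt uF
      (-(eulerF q ^ 5 / (q * eulerF (q ^ 5)) * √(125 + 22 * uF q + uF q ^ 2)))
      (Set.Ioo 0 ρ₁) q :=
    fun q hq ↦ (LevelFive.hasDerivAt_uF_sqrt (hsub hq)).hasDerivWithinAt
  have hinj : Set.InjOn uF (Set.Ioo 0 ρ₁) := LevelFive.strictAntiOn_uF.injOn.mono hsub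
  have himg : uF '' Set.Ioo 0 ρ₁ = Set.Ioi (1 / 2) := by rw [LevelFive.image_uF hρ, huρ]
  have hR := LevelFive.integrableOn_rpow_div_sqrt hk (show (0 : ℝ) < 1 / 2 by norm_num)
  have hcongr : Set.EqOn _ _ (Set.Ioo 0 ρ₁) := fun q hq ↦ LevelFive.integrand_eq (hsub hq) k
  have hint := (integrableOn_image_iff_integrableOn_abs_deriv_smul measurableSet_Ioo hderiv hinj
    (fun x ↦ x ^ (k - 1) / √(125 + 22 * x + x ^ 2))).mp (himg ▸ hR)
  have heq := integral_image_eq_integral_abs_deriv_smul measurableSet_Ioo hderiv hinj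
    (fun x ↦ x ^ (k - 1) / √(125 + 22 * x + x ^ 2))
  refine ⟨?_, hR, ?_⟩
  · rw [intervalIntegrable_iff_integrableOn_Ioo_of_le hρ.1.le]
    exact hint.congr_fun hcongr measurableSet_Ioo
  · rw [intervalIntegral.integral_of_le hρ.1.le, integral_Ioc_eq_integral_Ioo, ← himg, heq]
    exact (setIntegral_congr_fun measurableSet_Ioo hcongr).symm
end

section
/- For every real k > -1 and every a with 0 < a < 1, ∫_0^a (f(-q^5)/f(-q))^{6k+5} · f(-q)^4 · q^k dq = ∫_0^∞ dx / ((x + u(a))^{k+1} · √((x + u(a) + 11)² + 4)), both improper integrals being convergent. -/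
open MeasureTheory Real

open Filter Topology

/-- The theta-type series `∑ₙ cₙ (n + h)ʲ exp (L (n + h)² / 2 + t (n + h))`. -/
noncomputable def thetaSeries (c : ℤ → ℝ) (h : ℝ) (j : ℕ) (L t : ℝ) : ℝ :=
  ∑' n : ℤ, c n * (n + h) ^ j * exp (L * (n + h) ^ 2 / 2 + t * (n + h))

lemma summable_exp_quadratic (h : ℝ) {L : ℝ} (hL : L < 0) (t : ℝ) :
    Summable fun n : ℤ => exp (L * (n + h) ^ 2 / 2 + t * (n + h)) := by
  have hT : 0 < -L / (2 * π) := div_pos (by linarith) (by positivity)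
  have := (summable_pow_mul_jacobiTheta₂_term_bound (|L * h + t| / (2 * π)) hT 0).mul_left
    (exp (L * h ^ 2 / 2 + t * h))
  refine this.of_nonneg_of_le (fun n => (exp_pos _).le) fun n => ?_
  simp only [pow_zero, one_mul]
  rw [← exp_add]
  apply exp_le_exp.mpr
  have h1 : (L * h + t) * n ≤ |L * h + t| * |(n : ℝ)| := by
    rw [← abs_mul]; exact le_abs_self _
  have h2 : -π * (-L / (2 * π) * (n : ℝ) ^ 2 - 2 * (|L * h + t| / (2 * π)) * |(n : ℝ)|)
      = L * n ^ 2 / 2 + |L * h + t| * |(n : ℝ)| := by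
    field_simp; ring
  push_cast
  rw [h2]
  nlinarith

lemma summable_pow_mul_exp_quadratic (h : ℝ) (j : ℕ) {L : ℝ} (hL : L < 0) (t : ℝ) :
    Summable fun n : ℤ => |n + h| ^ j * exp (L * (n + h) ^ 2 / 2 + t * (n + h)) := by
  have := ((summable_exp_quadratic h hL (t + 1)).add
    (summable_exp_quadratic h hL (t - 1))).mul_left (j.factorial : ℝ)
  refine this.of_nonneg_of_le (fun n => by positivity) fun n => ?_
  have h1 := Real.pow_div_factorial_le_exp _ (abs_nonneg ((n : ℝ) + h)) j
  rw [div_le_iff₀ (by positivity)] at h1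
  have h2 : exp |(n : ℝ) + h| ≤ exp (n + h) + exp (-(n + h)) := by
    rcases abs_choice ((n : ℝ) + h) with h' | h' <;> rw [h'] <;>
      linarith [exp_pos ((n : ℝ) + h), exp_pos (-((n : ℝ) + h))]
  calc _ ≤ ((exp (n + h) + exp (-(n + h))) * j.factorial) *
        exp (L * (n + h) ^ 2 / 2 + t * (n + h)) := by gcongr; exact h1.trans (by gcongr)
    _ = _ := by
      rw [show L * ((n : ℝ) + h) ^ 2 / 2 + (t + 1) * (n + h)
        = (n + h) + (L * (n + h) ^ 2 / 2 + t * (n + h)) by ring,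
        show L * ((n : ℝ) + h) ^ 2 / 2 + (t - 1) * (n + h)
        = -(n + h) + (L * (n + h) ^ 2 / 2 + t * (n + h)) by ring,
        exp_add ((n : ℝ) + h), exp_add (-((n : ℝ) + h))]
      ring

lemma summable_thetaSeries {c : ℤ → ℝ} (hc : ∀ n, |c n| ≤ 1) (h : ℝ) (j : ℕ) {L : ℝ} (hL : L < 0)
    (t : ℝ) :
    Summable fun n : ℤ => c n * (n + h) ^ j * exp (L * (n + h) ^ 2 / 2 + t * (n + h)) := by
  refine (summable_pow_mul_exp_quadratic h j hL t).of_norm_bounded fun n => ?_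
  rw [norm_mul, norm_mul, norm_pow, Real.norm_eq_abs, Real.norm_eq_abs, Real.norm_eq_abs, abs_exp]
  have := hc n
  gcongr
  exact mul_le_of_le_one_left (by positivity) this

/-- Differentiating the series along an affine curve; this contains the heat equation. -/
lemma hasDerivAt_thetaSeries {c : ℤ → ℝ} (hc : ∀ n, |c n| ≤ 1) (h : ℝ) (j : ℕ)
    (L₀ α t₀ β u : ℝ) (hL : L₀ + α * u < 0) :
    HasDerivAt (fun u => thetaSeries c h j (L₀ + α * u) (t₀ + β * u))
      (α / 2 * thetaSeries c h (j + 2) (L₀ + α * u) (t₀ + β * u) +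
        β * thetaSeries c h (j + 1) (L₀ + α * u) (t₀ + β * u)) u := by
  obtain ⟨δ, hδ, hball⟩ : ∃ δ > 0, ∀ v, |v - u| ≤ δ → L₀ + α * v < 0 := by
    refine ⟨-(L₀ + α * u) / (2 * (|α| + 1)), div_pos (by linarith) (by positivity), fun v hv => ?_⟩
    have h1 : α * (v - u) ≤ |α| * |v - u| := by rw [← abs_mul]; exact le_abs_self _
    rw [le_div_iff₀ (by positivity)] at hv
    nlinarith [abs_nonneg α, abs_nonneg (v - u)]
  have hm := hball (u - δ) (by rw [abs_le]; constructor <;> linarith)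
  have hp := hball (u + δ) (by rw [abs_le]; constructor <;> linarith)
  set bnd : ℝ → ℤ → ℝ := fun v n =>
    |α| / 2 * (|n + h| ^ (j + 2) * exp ((L₀ + α * v) * (n + h) ^ 2 / 2 + (t₀ + β * v) * (n + h))) +
    |β| * (|n + h| ^ (j + 1) * exp ((L₀ + α * v) * (n + h) ^ 2 / 2 + (t₀ + β * v) * (n + h)))
    with hbnd
  have hs : ∀ v, L₀ + α * v < 0 → Summable (bnd v) := fun v hv =>
    ((summable_pow_mul_exp_quadratic h (j + 2) hv _).mul_left _).add
      ((summable_pow_mul_exp_quadratic h (j + 1) hv _).mul_left _)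
  have key := hasDerivAt_tsum_of_isPreconnected (𝕜 := ℝ) (u := fun n => bnd (u - δ) n + bnd (u + δ) n)
    (t := Set.Ioo (u - δ) (u + δ))
    (g := fun n v => c n * (n + h) ^ j *
      exp ((L₀ + α * v) * (n + h) ^ 2 / 2 + (t₀ + β * v) * (n + h)))
    (g' := fun n v => c n * (n + h) ^ j *
      (exp ((L₀ + α * v) * (n + h) ^ 2 / 2 + (t₀ + β * v) * (n + h)) *
        (α / 2 * (n + h) ^ 2 + β * (n + h)))) (y₀ := u) (y := u)
    ((hs _ hm).add (hs _ hp)) isOpen_Ioo isPreconnected_Ioo ?_ ?_ (by constructor <;> linarith)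
    (summable_thetaSeries hc h j hL _) (by constructor <;> linarith)
  · refine key.congr_deriv ?_
    unfold thetaSeries
    rw [← tsum_mul_left, ← tsum_mul_left, ← Summable.tsum_add
      ((summable_thetaSeries hc h (j + 2) hL _).mul_left _)
      ((summable_thetaSeries hc h (j + 1) hL _).mul_left _)]
    refine tsum_congr fun n => ?_
    ring
  · intro n v _
    refine HasDerivAt.const_mul _ (HasDerivAt.exp ?_)
    have h1 : HasDerivAt (fun v : ℝ => v) 1 v := hasDerivAt_id v
    refine (((((h1.const_mul α).const_add L₀).mul_const (((n : ℝ) + h) ^ 2)).div_const 2).add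
      (((h1.const_mul β).const_add t₀).mul_const ((n : ℝ) + h))).congr_deriv ?_
    ring
  · intro n v hv
    set e : ℝ → ℝ := fun v =>
      exp ((L₀ + α * v) * (n + h) ^ 2 / 2 + (t₀ + β * v) * (n + h)) with he
    have hle : e v ≤ e (u - δ) + e (u + δ) := by
      have : e v ≤ max (e (u - δ)) (e (u + δ)) := by
        simp only [he]
        rw [le_max_iff, exp_le_exp, exp_le_exp]
        rcases le_total 0 (α * (n + h) ^ 2 / 2 + β * (n + h)) with hs | hs
        · right; nlinarith [mul_le_mul_of_nonneg_left hv.2.le hs]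
        · left; nlinarith [mul_le_mul_of_nonpos_left hv.1.le hs]
      exact this.trans (max_le_add_of_nonneg (exp_pos _).le (exp_pos _).le)
    have hcn := hc n
    have hev : 0 < e v := exp_pos _
    calc ‖c n * (n + h) ^ j * (e v * (α / 2 * (n + h) ^ 2 + β * (n + h)))‖
        = |c n| * |n + h| ^ j * (e v * |α / 2 * (n + h) ^ 2 + β * (n + h)|) := by
          rw [Real.norm_eq_abs, abs_mul, abs_mul, abs_mul, abs_pow, abs_of_pos hev]
      _ ≤ 1 * |n + h| ^ j * ((e (u - δ) + e (u + δ)) *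
          (|α| / 2 * |n + h| ^ 2 + |β| * |n + h|)) := by
          gcongr
          refine (abs_add_le _ _).trans (le_of_eq ?_)
          rw [abs_mul, abs_mul, abs_div, abs_pow, abs_two]
      _ = bnd (u - δ) n + bnd (u + δ) n := by
          simp only [hbnd, he]; ring

lemma abs_neg_one_zpow_le (n : ℤ) : |(-1 : ℝ) ^ n| ≤ 1 := by
  rw [abs_zpow]; simp

/-- The `j`-th derivative in `t` of the odd theta function
`∑ₙ (-1)ⁿ exp (L (n + 1/2)² / 2 + t (n + 1/2))`. -/
noncomputable def oddTheta (j : ℕ) (L t : ℝ) : ℝ := thetaSeries (fun n => (-1) ^ n) (1 / 2) j L t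

lemma oddTheta_neg (j : ℕ) (L t : ℝ) : oddTheta j L (-t) = -(-1) ^ j * oddTheta j L t := by
  unfold oddTheta thetaSeries
  rw [← tsum_mul_left, ← (Equiv.subLeft (-1 : ℤ)).tsum_eq]
  refine tsum_congr fun n => ?_
  simp only [Equiv.subLeft_apply]
  push_cast
  rw [zpow_sub₀ (by norm_num), show (-1 - (n : ℝ) + 1 / 2) = -1 * (n + 1 / 2) by ring, mul_pow,
    show L * (-1 * ((n : ℝ) + 1 / 2)) ^ 2 / 2 + -t * (-1 * (n + 1 / 2))
      = L * (n + 1 / 2) ^ 2 / 2 + t * (n + 1 / 2) by ring]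
  rcases Int.even_or_odd n with hn | hn
  · rw [hn.neg_one_zpow]; norm_num; ring
  · rw [hn.neg_one_zpow]; norm_num; ring

lemma oddTheta_zero_zero (L : ℝ) : oddTheta 0 L 0 = 0 := by
  have := oddTheta_neg 0 L 0
  simp only [neg_zero, pow_zero] at this
  linarith

lemma oddTheta_sub_eq_tsum (j : ℕ) (L t : ℝ) :
    oddTheta j L (L - t) = ∑' n : ℤ, exp (-L / 2 + t) * ((-1) ^ n * (-((n : ℝ) + 1 / 2) - 1) ^ j *
      exp (L * (n + 1 / 2) ^ 2 / 2 + t * (n + 1 / 2))) := by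
  unfold oddTheta thetaSeries
  rw [← (Equiv.subLeft (-2 : ℤ)).tsum_eq]
  refine tsum_congr fun n => ?_
  simp only [Equiv.subLeft_apply]
  push_cast
  rw [zpow_sub₀ (by norm_num), show (-2 - (n : ℝ) + 1 / 2) = -(n + 1 / 2) - 1 by ring,
    show L * (-((n : ℝ) + 1 / 2) - 1) ^ 2 / 2 + (L - t) * (-(n + 1 / 2) - 1)
      = (-L / 2 + t) + (L * (n + 1 / 2) ^ 2 / 2 + t * (n + 1 / 2)) by ring, exp_add]
  rcases Int.even_or_odd n with hn | hn
  · rw [hn.neg_one_zpow]; norm_num; ring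
  · rw [hn.neg_one_zpow]; norm_num; ring

lemma summable_oddTheta (j : ℕ) {L : ℝ} (hL : L < 0) (t : ℝ) : Summable fun n : ℤ =>
    (-1 : ℝ) ^ n * (n + 1 / 2) ^ j * exp (L * (n + 1 / 2) ^ 2 / 2 + t * (n + 1 / 2)) :=
  summable_thetaSeries abs_neg_one_zpow_le (1 / 2) j hL t

lemma oddTheta_zero_sub (L t : ℝ) :
    oddTheta 0 L (L - t) = exp (-L / 2 + t) * oddTheta 0 L t := by
  rw [oddTheta_sub_eq_tsum, tsum_mul_left]
  simp [oddTheta, thetaSeries]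

lemma oddTheta_one_sub {L : ℝ} (hL : L < 0) (t : ℝ) :
    oddTheta 1 L (L - t) = -(exp (-L / 2 + t) * (oddTheta 0 L t + oddTheta 1 L t)) := by
  rw [oddTheta_sub_eq_tsum, tsum_mul_left, oddTheta, oddTheta, thetaSeries, thetaSeries,
    ← (summable_oddTheta 0 hL t).tsum_add (summable_oddTheta 1 hL t), ← mul_neg, ← tsum_neg]
  congr 1
  exact tsum_congr fun n => by ring

lemma oddTheta_two_sub {L : ℝ} (hL : L < 0) (t : ℝ) : oddTheta 2 L (L - t) =
    exp (-L / 2 + t) * (oddTheta 0 L t + 2 * oddTheta 1 L t + oddTheta 2 L t) := by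
  have := (((summable_oddTheta 0 hL t).hasSum.add ((summable_oddTheta 1 hL t).hasSum.mul_left 2)).add
    (summable_oddTheta 2 hL t).hasSum).tsum_eq
  rw [oddTheta_sub_eq_tsum, tsum_mul_left]
  congr 1
  exact Eq.trans (tsum_congr fun n => by ring) this

lemma hasDerivAt_oddTheta_comp (j : ℕ) (L₀ α t₀ β u : ℝ) (hL : L₀ + α * u < 0) :
    HasDerivAt (fun u => oddTheta j (L₀ + α * u) (t₀ + β * u))
      (α / 2 * oddTheta (j + 2) (L₀ + α * u) (t₀ + β * u) +
        β * oddTheta (j + 1) (L₀ + α * u) (t₀ + β * u)) u :=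
  hasDerivAt_thetaSeries abs_neg_one_zpow_le (1 / 2) j L₀ α t₀ β u hL

lemma hasDerivAt_oddTheta (j : ℕ) {L : ℝ} (hL : L < 0) (t : ℝ) :
    HasDerivAt (fun t => oddTheta j L t) (oddTheta (j + 1) L t) t := by
  simpa using hasDerivAt_oddTheta_comp j L 0 0 1 t (by simpa using hL)

/-- The even theta functions of doubled argument, `h = 0` or `h = 1/2`. -/
noncomputable def dblTheta (h : ℝ) (j : ℕ) (L t : ℝ) : ℝ :=
  2 ^ j * thetaSeries (fun _ => 1) h j (2 * L) (2 * t)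

lemma hasDerivAt_dblTheta (h : ℝ) (j : ℕ) {L : ℝ} (hL : L < 0) (t : ℝ) :
    HasDerivAt (fun t => dblTheta h j L t) (dblTheta h (j + 1) L t) t := by
  have := (hasDerivAt_thetaSeries (c := fun _ => 1) (by simp) h j (2 * L) 0 0 2 t
    (by linarith)).const_mul (2 ^ j)
  simp only [zero_mul, add_zero, zero_add, zero_div] at this
  refine this.congr_deriv ?_
  unfold dblTheta
  ring

lemma oddTheta_mul_oddTheta {L : ℝ} (hL : L < 0) (x y : ℝ) :
    oddTheta 0 L (x + y) * oddTheta 0 L (x - y) =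
      dblTheta (1 / 2) 0 L x * dblTheta 0 0 L y - dblTheta 0 0 L x * dblTheta (1 / 2) 0 L y := by
  have s1 := summable_oddTheta 0 hL (x + y)
  have s2 := summable_oddTheta 0 hL (x - y)
  have e (h z : ℝ) : Summable fun n : ℤ => (1 : ℝ) * (n + h) ^ 0 *
      exp (2 * L * (n + h) ^ 2 / 2 + 2 * z * (n + h)) :=
    summable_thetaSeries (c := fun _ => 1) (by simp) h 0 (by linarith) _
  have hprod := (summable_mul_of_summable_norm s1.norm s2.norm).hasSum
  rw [← tsum_mul_tsum_of_summable_norm s1.norm s2.norm] at hprod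
  have h1 := (summable_mul_of_summable_norm (e (1 / 2) x).norm (e 0 y).norm).hasSum
  rw [← tsum_mul_tsum_of_summable_norm (e (1 / 2) x).norm (e 0 y).norm] at h1
  have h2 := (summable_mul_of_summable_norm (e 0 x).norm (e (1 / 2) y).norm).hasSum
  rw [← tsum_mul_tsum_of_summable_norm (e 0 x).norm (e (1 / 2) y).norm] at h2
  set F : ℤ × ℤ → ℝ := fun z =>
    ((-1 : ℝ) ^ z.1 * (z.1 + 1 / 2) ^ 0 *
      exp (L * (z.1 + 1 / 2) ^ 2 / 2 + (x + y) * (z.1 + 1 / 2))) *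
    ((-1 : ℝ) ^ z.2 * (z.2 + 1 / 2) ^ 0 *
      exp (L * (z.2 + 1 / 2) ^ 2 / 2 + (x - y) * (z.2 + 1 / 2))) with hF
  let p : ℤ × ℤ → ℤ × ℤ := fun z => (z.1 + z.2, z.1 - z.2)
  let p' : ℤ × ℤ → ℤ × ℤ := fun z => (z.1 + z.2, z.1 - z.2 - 1)
  have hp : Function.Injective p := by
    rintro ⟨a, b⟩ ⟨c, d⟩ h
    simp only [p, Prod.mk.injEq] at h ⊢
    omega
  have hp' : Function.Injective p' := by
    rintro ⟨a, b⟩ ⟨c, d⟩ h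
    simp only [p', Prod.mk.injEq] at h ⊢
    omega
  have hcompl : IsCompl (Set.range p) (Set.range p') := by
    refine IsCompl.of_eq ?_ ?_
    · refine Set.eq_empty_of_forall_notMem ?_
      rintro _ ⟨⟨⟨a, b⟩, rfl⟩, ⟨c, d⟩, h⟩
      simp only [p, p', Prod.mk.injEq] at h
      omega
    · refine Set.eq_univ_of_forall ?_
      rintro ⟨a, b⟩
      rcases Int.even_or_odd' (a + b) with ⟨k, hk | hk⟩
      · exact Or.inl ⟨(k, a - k), by simp only [p, Prod.mk.injEq]; omega⟩
      · exact Or.inr ⟨(k + 1, a - (k + 1)), by simp only [p', Prod.mk.injEq]; omega⟩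
  have h1' : HasSum (F ∘ p) (dblTheta (1 / 2) 0 L x * dblTheta 0 0 L y) := by
    simp only [dblTheta, thetaSeries, pow_zero, one_mul] at h1 ⊢
    convert! h1 using 1
    ext ⟨k, l⟩
    simp only [hF, p, Function.comp_apply, pow_zero, mul_one]
    push_cast
    rw [mul_mul_mul_comm, ← exp_add, ← exp_add, ← zpow_add₀ (by norm_num),
      show k + l + (k - l) = k + k by ring, (Even.add_self k).neg_one_zpow, one_mul]
    congr 1
    ring
  have h2' : HasSum (F ∘ p') (-(dblTheta 0 0 L x * dblTheta (1 / 2) 0 L y)) := by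
    have h2 := h2.neg
    simp only [dblTheta, thetaSeries, pow_zero, one_mul] at h2 ⊢
    convert! h2 using 1
    ext ⟨k, l⟩
    simp only [hF, p', Function.comp_apply, pow_zero, mul_one]
    push_cast
    rw [mul_mul_mul_comm, ← exp_add, ← exp_add, ← zpow_add₀ (by norm_num),
      show k + l + (k - l - 1) = k + k - 1 by ring, ((Even.add_self k).sub_odd odd_one).neg_one_zpow,
      neg_one_mul]
    congr 2
    ring
  have := HasSum.add_isCompl (f := F) hcompl (hp.hasSum_range_iff.2 h1')
    (hp'.hasSum_range_iff.2 h2')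
  exact hprod.unique (by rw [← sub_eq_add_neg] at this; exact this)

lemma oddTheta_product_derivatives {L : ℝ} (hL : L < 0) (x z : ℝ) :
    (oddTheta 1 L (x + z) * oddTheta 0 L (x - z) - oddTheta 0 L (x + z) * oddTheta 1 L (x - z) =
      dblTheta (1 / 2) 0 L x * dblTheta 0 1 L z - dblTheta 0 0 L x * dblTheta (1 / 2) 1 L z) ∧
    (oddTheta 2 L (x + z) * oddTheta 0 L (x - z) - 2 * oddTheta 1 L (x + z) * oddTheta 1 L (x - z)
        + oddTheta 0 L (x + z) * oddTheta 2 L (x - z) =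
      dblTheta (1 / 2) 0 L x * dblTheta 0 2 L z - dblTheta 0 0 L x * dblTheta (1 / 2) 2 L z) ∧
    (oddTheta 3 L (x + z) * oddTheta 0 L (x - z) - 3 * oddTheta 2 L (x + z) * oddTheta 1 L (x - z)
        + 3 * oddTheta 1 L (x + z) * oddTheta 2 L (x - z)
        - oddTheta 0 L (x + z) * oddTheta 3 L (x - z) =
      dblTheta (1 / 2) 0 L x * dblTheta 0 3 L z - dblTheta 0 0 L x * dblTheta (1 / 2) 3 L z) := by
  have dp (j : ℕ) (z : ℝ) : HasDerivAt (fun z => oddTheta j L (x + z)) (oddTheta (j + 1) L (x + z)) z :=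
    (hasDerivAt_oddTheta j hL (x + z)).comp_const_add x z
  have dm (j : ℕ) (z : ℝ) :
      HasDerivAt (fun z => oddTheta j L (x - z)) (-oddTheta (j + 1) L (x - z)) z :=
    (hasDerivAt_oddTheta j hL (x - z)).comp_const_sub x z
  have dr (j : ℕ) (z : ℝ) : HasDerivAt (fun z => dblTheta (1 / 2) 0 L x * dblTheta 0 j L z -
      dblTheta 0 0 L x * dblTheta (1 / 2) j L z) (dblTheta (1 / 2) 0 L x * dblTheta 0 (j + 1) L z -
      dblTheta 0 0 L x * dblTheta (1 / 2) (j + 1) L z) z :=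
    ((hasDerivAt_dblTheta 0 j hL z).const_mul _).sub ((hasDerivAt_dblTheta _ j hL z).const_mul _)
  have h1 (z : ℝ) : oddTheta 1 L (x + z) * oddTheta 0 L (x - z) -
      oddTheta 0 L (x + z) * oddTheta 1 L (x - z) =
      dblTheta (1 / 2) 0 L x * dblTheta 0 1 L z - dblTheta 0 0 L x * dblTheta (1 / 2) 1 L z := by
    refine HasDerivAt.unique (((dp 0 z).mul (dm 0 z)).congr_deriv (by ring)) ?_
    convert! dr 0 z using 1
    funext w
    exact oddTheta_mul_oddTheta hL x w
  have h2 (z : ℝ) : oddTheta 2 L (x + z) * oddTheta 0 L (x - z) -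
      2 * oddTheta 1 L (x + z) * oddTheta 1 L (x - z) + oddTheta 0 L (x + z) * oddTheta 2 L (x - z) =
      dblTheta (1 / 2) 0 L x * dblTheta 0 2 L z - dblTheta 0 0 L x * dblTheta (1 / 2) 2 L z := by
    refine HasDerivAt.unique ((((dp 1 z).mul (dm 0 z)).sub
      ((dp 0 z).mul (dm 1 z))).congr_deriv (by ring)) ?_
    convert! dr 1 z using 1
    funext w
    exact h1 w
  refine ⟨h1 z, h2 z, ?_⟩
  refine HasDerivAt.unique (((((dp 2 z).mul (dm 0 z)).sub (((dp 1 z).const_mul 2).mul (dm 1 z))).add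
    ((dp 0 z).mul (dm 2 z))).congr_deriv (by ring)) ?_
  convert! dr 2 z using 1
  funext w
  exact h2 w

lemma oddTheta_two_zero (L : ℝ) : oddTheta 2 L 0 = 0 := by
  have := oddTheta_neg 2 L 0
  norm_num at this
  linarith

lemma dblTheta_wronskian {L : ℝ} (hL : L < 0) (x : ℝ) :
    dblTheta 0 0 L x * dblTheta (1 / 2) 1 L x - dblTheta (1 / 2) 0 L x * dblTheta 0 1 L x =
      oddTheta 1 L 0 * oddTheta 0 L (2 * x) := by
  have := (oddTheta_product_derivatives hL x x).1
  rw [sub_self, oddTheta_zero_zero, ← two_mul] at this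
  linarith

/-- The duplication formula `(2 ζ(x) - ζ(2x))² = 2 ℘(x) + ℘(2x) + const`, cleared of
denominators. -/
lemma oddTheta_duplication {L : ℝ} (hL : L < 0) (x : ℝ) :
    oddTheta 1 L 0 * (2 * (oddTheta 1 L x ^ 2 + oddTheta 0 L x * oddTheta 2 L x) *
        oddTheta 0 L (2 * x) - 4 * oddTheta 0 L x * oddTheta 1 L x * oddTheta 1 L (2 * x) +
        oddTheta 0 L x ^ 2 * oddTheta 2 L (2 * x)) =
      oddTheta 3 L 0 * oddTheta 0 L x ^ 2 * oddTheta 0 L (2 * x) := by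
  have e0 := oddTheta_mul_oddTheta hL 0 x
  obtain ⟨e1, e2, -⟩ := oddTheta_product_derivatives hL 0 x
  obtain ⟨f1, f2, f3⟩ := oddTheta_product_derivatives hL x x
  rw [zero_add, zero_sub] at e0 e1 e2
  rw [oddTheta_neg] at e0 e1 e2
  rw [oddTheta_neg 1] at e1 e2
  rw [oddTheta_neg 2] at e2
  rw [sub_self, oddTheta_zero_zero, ← two_mul] at f1 f2 f3
  rw [oddTheta_two_zero] at f2 f3
  have da (j : ℕ) (z : ℝ) := hasDerivAt_dblTheta 0 j hL z
  have db (j : ℕ) (z : ℝ) := hasDerivAt_dblTheta (1 / 2) j hL z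
  have d2 (j : ℕ) (z : ℝ) : HasDerivAt (fun z => oddTheta 1 L 0 * oddTheta j L (2 * z))
      (oddTheta 1 L 0 * (2 * oddTheta (j + 1) L (2 * z))) z := by
    have := ((hasDerivAt_oddTheta j hL (2 * z)).comp z ((hasDerivAt_id z).const_mul 2)).const_mul
      (oddTheta 1 L 0)
    refine this.congr_deriv ?_
    ring
  have w1 (z : ℝ) : dblTheta 0 0 L z * dblTheta (1 / 2) 2 L z -
      dblTheta (1 / 2) 0 L z * dblTheta 0 2 L z = 2 * (oddTheta 1 L 0 * oddTheta 1 L (2 * z)) := by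
    have := (oddTheta_product_derivatives hL z z).2.1
    rw [sub_self, oddTheta_zero_zero, oddTheta_two_zero, ← two_mul] at this
    linarith
  have w2 : dblTheta 0 1 L x * dblTheta (1 / 2) 2 L x + dblTheta 0 0 L x * dblTheta (1 / 2) 3 L x -
      (dblTheta (1 / 2) 1 L x * dblTheta 0 2 L x + dblTheta (1 / 2) 0 L x * dblTheta 0 3 L x) =
      4 * (oddTheta 1 L 0 * oddTheta 2 L (2 * x)) := by
    have hd := (d2 1 x).const_mul 2
    rw [show (fun z => 2 * (oddTheta 1 L 0 * oddTheta 1 L (2 * z))) = fun z =>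
      dblTheta 0 0 L z * dblTheta (1 / 2) 2 L z - dblTheta (1 / 2) 0 L z * dblTheta 0 2 L z from
      funext fun z => (w1 z).symm] at hd
    have := (((da 0 x).mul (db 2 x)).sub ((db 0 x).mul (da 2 x))).unique hd
    linarith
  have w0 := dblTheta_wronskian hL x
  have w1 := w1 x
  have w3 : dblTheta 0 1 L x * dblTheta (1 / 2) 2 L x - dblTheta (1 / 2) 1 L x * dblTheta 0 2 L x =
      oddTheta 1 L 0 * oddTheta 2 L (2 * x) - oddTheta 3 L 0 * oddTheta 0 L (2 * x) := by
    linarith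
  have q0 : oddTheta 0 L x ^ 2 = dblTheta 0 0 L 0 * dblTheta (1 / 2) 0 L x -
      dblTheta (1 / 2) 0 L 0 * dblTheta 0 0 L x := by linarith
  have q1 : 2 * oddTheta 0 L x * oddTheta 1 L x = dblTheta 0 0 L 0 * dblTheta (1 / 2) 1 L x -
      dblTheta (1 / 2) 0 L 0 * dblTheta 0 1 L x := by linarith
  have q2 : 2 * (oddTheta 1 L x ^ 2 + oddTheta 0 L x * oddTheta 2 L x) =
      dblTheta 0 0 L 0 * dblTheta (1 / 2) 2 L x -
      dblTheta (1 / 2) 0 L 0 * dblTheta 0 2 L x := by linarith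
  linear_combination (oddTheta 1 L 0 * oddTheta 0 L (2 * x)) * q2
    - (2 * oddTheta 1 L 0 * oddTheta 1 L (2 * x)) * q1
    + (oddTheta 1 L 0 * oddTheta 2 L (2 * x) - oddTheta 3 L 0 * oddTheta 0 L (2 * x)) * q0
    - (dblTheta 0 0 L 0 * dblTheta (1 / 2) 2 L x - dblTheta (1 / 2) 0 L 0 * dblTheta 0 2 L x) * w0
    + (dblTheta 0 0 L 0 * dblTheta (1 / 2) 1 L x - dblTheta (1 / 2) 0 L 0 * dblTheta 0 1 L x) * w1
    - (dblTheta 0 0 L 0 * dblTheta (1 / 2) 0 L x - dblTheta (1 / 2) 0 L 0 * dblTheta 0 0 L x) * w3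

/-- `3 ζ(x) - ζ(3x) = σ(2x)³ / (σ(x)³ σ(3x))`, cleared of denominators. -/
lemma oddTheta_triplication {L : ℝ} (hL : L < 0) (x : ℝ) :
    3 * oddTheta 0 L x ^ 2 * oddTheta 1 L x * oddTheta 0 L (3 * x) -
      oddTheta 0 L x ^ 3 * oddTheta 1 L (3 * x) = oddTheta 1 L 0 * oddTheta 0 L (2 * x) ^ 3 := by
  have e0 := oddTheta_mul_oddTheta hL 0 x
  have e1 := (oddTheta_product_derivatives hL 0 x).1
  have g0 := oddTheta_mul_oddTheta hL 0 (2 * x)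
  have f0 := oddTheta_mul_oddTheta hL (2 * x) x
  have f1 := (oddTheta_product_derivatives hL (2 * x) x).1
  have w0 := dblTheta_wronskian hL x
  rw [zero_add, zero_sub] at e0 e1 g0
  rw [oddTheta_neg] at e0 e1 g0
  rw [oddTheta_neg 1] at e1
  rw [show 2 * x + x = 3 * x by ring, show 2 * x - x = x by ring] at f0 f1
  have q0 : oddTheta 0 L x ^ 2 = dblTheta 0 0 L 0 * dblTheta (1 / 2) 0 L x -
      dblTheta (1 / 2) 0 L 0 * dblTheta 0 0 L x := by linarith
  have q1 : 2 * oddTheta 0 L x * oddTheta 1 L x = dblTheta 0 0 L 0 * dblTheta (1 / 2) 1 L x -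
      dblTheta (1 / 2) 0 L 0 * dblTheta 0 1 L x := by linarith
  have q2 : oddTheta 0 L (2 * x) ^ 2 = dblTheta 0 0 L 0 * dblTheta (1 / 2) 0 L (2 * x) -
      dblTheta (1 / 2) 0 L 0 * dblTheta 0 0 L (2 * x) := by linarith
  linear_combination (oddTheta 0 L (3 * x) * oddTheta 0 L x) * q1
    + (dblTheta 0 0 L 0 * dblTheta (1 / 2) 1 L x - dblTheta (1 / 2) 0 L 0 * dblTheta 0 1 L x) * f0
    - (oddTheta 1 L (3 * x) * oddTheta 0 L x - oddTheta 0 L (3 * x) * oddTheta 1 L x) * q0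
    - (dblTheta 0 0 L 0 * dblTheta (1 / 2) 0 L x - dblTheta (1 / 2) 0 L 0 * dblTheta 0 0 L x) * f1
    - (oddTheta 1 L 0 * oddTheta 0 L (2 * x)) * q2
    + (dblTheta 0 0 L 0 * dblTheta (1 / 2) 0 L (2 * x) -
        dblTheta (1 / 2) 0 L 0 * dblTheta 0 0 L (2 * x)) * w0

lemma tendsto_prod_eulerF {q : ℝ} (h0 : 0 < q) (h1 : q < 1) :
    Tendsto (fun n => ∏ k ∈ Finset.range n, (1 - q ^ (k + 1))) atTop (𝓝 (eulerF q)) := by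
  have hm : Multipliable fun n : ℕ => 1 - q ^ (n + 1) := by
    have := multipliable_one_add_of_summable (f := fun n : ℕ => -q ^ (n + 1)) (by
      simpa [abs_of_pos h0] using
        (summable_nat_add_iff 1).mpr (summable_geometric_of_lt_one h0.le h1))
    simpa [sub_eq_add_neg] using this
  exact hm.hasProd.tendsto_prod_nat

lemma prod_one_sub_pow_antitone {q : ℝ} (h0 : 0 < q) (h1 : q < 1) :
    Antitone fun n => ∏ k ∈ Finset.range n, (1 - q ^ (k + 1)) := by
  refine antitone_nat_of_succ_le fun n => ?_
  rw [Finset.prod_range_succ]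
  refine mul_le_of_le_one_right (Finset.prod_nonneg fun k _ => ?_) ?_
  · have := pow_lt_one₀ h0.le h1 (by omega : k + 1 ≠ 0)
    linarith
  · linarith [pow_pos h0 (n + 1)]

lemma eulerF_le_prod {q : ℝ} (h0 : 0 < q) (h1 : q < 1) (n : ℕ) :
    eulerF q ≤ ∏ k ∈ Finset.range n, (1 - q ^ (k + 1)) :=
  (prod_one_sub_pow_antitone h0 h1).le_of_tendsto (tendsto_prod_eulerF h0 h1) n

lemma eulerF_le_one {q : ℝ} (h0 : 0 < q) (h1 : q < 1) : eulerF q ≤ 1 := by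
  simpa using eulerF_le_prod h0 h1 0

lemma eulerF_pos {q : ℝ} (h0 : 0 < q) (h1 : q < 1) : 0 < eulerF q := by
  refine lt_of_le_of_ne ?_ (Ne.symm ?_)
  · refine ge_of_tendsto' (tendsto_prod_eulerF h0 h1) fun n => Finset.prod_nonneg fun k _ => ?_
    have := pow_lt_one₀ h0.le h1 (by omega : k + 1 ≠ 0)
    linarith
  · have := tprod_one_add_ne_zero_of_summable (f := fun n : ℕ => -q ^ (n + 1)) (fun n => by
      have := pow_lt_one₀ h0.le h1 (by omega : n + 1 ≠ 0)
      linarith) (by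
      simpa [abs_of_pos h0] using
        (summable_nat_add_iff 1).mpr (summable_geometric_of_lt_one h0.le h1))
    simpa [sub_eq_add_neg, eulerF] using this

lemma tendsto_eulerF_zero : Tendsto eulerF (𝓝 0) (𝓝 1) := by
  have h : ContinuousAt (fun q : ℂ => ∏' n : ℕ, (1 - q ^ (n + 1))) 0 :=
    (ModularForm.differentiableOn_tprod_one_sub_pow.differentiableAt
      (Metric.ball_mem_nhds 0 one_pos)).continuousAt
  have h2 : Tendsto (fun q : ℝ => (∏' n : ℕ, (1 - (q : ℂ) ^ (n + 1))).re) (𝓝 0) (𝓝 1) := by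
    have h3 : Tendsto (fun q : ℝ => (q : ℂ)) (𝓝 0) (𝓝 0) := Complex.continuous_ofReal.tendsto' 0 0 rfl
    have := (Complex.continuous_re.tendsto _).comp (h.tendsto.comp h3)
    simpa [Function.comp_def] using this
  refine h2.congr' ?_
  have hb : ∀ᶠ q : ℝ in 𝓝 0, |q| < 1 := by
    filter_upwards [Ioo_mem_nhds (show (-1 : ℝ) < 0 by norm_num) one_pos] with q hq
    exact abs_lt.mpr hq
  filter_upwards [hb] with q hq
  have hm : Multipliable fun n : ℕ => 1 - q ^ (n + 1) := by
    have := multipliable_one_add_of_summable (f := fun n : ℕ => -q ^ (n + 1)) (by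
      simpa using (summable_nat_add_iff 1).mpr (summable_geometric_of_lt_one (abs_nonneg q) hq))
    simpa [sub_eq_add_neg] using this
  have := hm.map_tprod Complex.ofRealHom Complex.continuous_ofReal
  simp only [Complex.ofRealHom_eq_coe, Complex.ofReal_sub, Complex.ofReal_one,
    Complex.ofReal_pow] at this
  rw [← this, Complex.ofReal_re, eulerF]

lemma exp_zpow_eq (L : ℝ) (j : ℤ) : exp L ^ j = exp (L * j) := by
  rw [exp_mul, rpow_intCast]

/-- `1 / (p; p)ₘ` with `p = exp L`, extended by zero to negative `m`. -/
noncomputable def qPochInv (L : ℝ) (m : ℤ) : ℝ :=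
  if m < 0 then 0 else (∏ k ∈ Finset.range m.toNat, (1 - exp L ^ (k + 1)))⁻¹

lemma one_sub_zpow_mul_qPochInv {L : ℝ} (hL : L < 0) (m : ℤ) :
    (1 - exp L ^ m) * qPochInv L m = qPochInv L (m - 1) := by
  rcases lt_trichotomy m 0 with h | rfl | h
  · rw [qPochInv, qPochInv, if_pos h, if_pos (by omega), mul_zero]
  · simp [qPochInv]
  · obtain ⟨n, rfl⟩ : ∃ n : ℕ, m = n + 1 := ⟨(m - 1).toNat, by omega⟩
    have : (1 - exp L ^ (n + 1)) ≠ 0 := by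
      have := pow_lt_one₀ (exp_pos L).le (exp_lt_one_iff.mpr hL) (by omega : n + 1 ≠ 0)
      linarith
    rw [qPochInv, qPochInv, if_neg (by omega), if_neg (by omega),
      show ((n : ℤ) + 1).toNat = n + 1 by omega, show ((n : ℤ) + 1 - 1).toNat = n by omega,
      Finset.prod_range_succ, mul_inv_rev, show exp L ^ ((n : ℤ) + 1) = exp L ^ (n + 1) by
        exact_mod_cast zpow_natCast (exp L) (n + 1), mul_inv_cancel_left₀ this]

lemma abs_qPochInv_le {L : ℝ} (hL : L < 0) (m : ℤ) : |qPochInv L m| ≤ (eulerF (exp L))⁻¹ := by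
  have hE := eulerF_pos (exp_pos L) (exp_lt_one_iff.mpr hL)
  unfold qPochInv
  split_ifs
  · simpa using hE.le
  · have := eulerF_le_prod (exp_pos L) (exp_lt_one_iff.mpr hL) m.toNat
    rw [abs_of_nonneg (inv_nonneg.mpr (hE.le.trans this))]
    exact inv_anti₀ hE this

lemma tendsto_qPochInv {L : ℝ} (hL : L < 0) :
    Tendsto (qPochInv L) atTop (𝓝 (eulerF (exp L))⁻¹) := by
  have hE := eulerF_pos (exp_pos L) (exp_lt_one_iff.mpr hL)
  have : Tendsto Int.toNat atTop atTop :=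
    tendsto_atTop.mpr fun b => (eventually_ge_atTop (b : ℤ)).mono fun a ha => by omega
  refine (((tendsto_prod_eulerF (exp_pos L) (exp_lt_one_iff.mpr hL)).inv₀ hE.ne').comp this).congr' ?_
  filter_upwards [eventually_ge_atTop (0 : ℤ)] with m hm
  simp [qPochInv, hm.not_gt]

/-- The coefficients of the finite form of the Jacobi triple product. -/
noncomputable def tripleCoeff (L : ℝ) (n : ℕ) (j : ℤ) : ℝ :=
  (-1) ^ j * exp (L * (j * (j + 1)) / 2) * (∏ k ∈ Finset.range (2 * n), (1 - exp L ^ (k + 1))) *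
    qPochInv L (n - j) * qPochInv L (n + j)

lemma tripleCoeff_zero (L : ℝ) (j : ℤ) : tripleCoeff L 0 j = if j = 0 then 1 else 0 := by
  unfold tripleCoeff qPochInv
  rcases lt_trichotomy j 0 with h | rfl | h
  · rw [if_neg h.ne]; simp [h]
  · simp
  · rw [if_neg h.ne']; simp [h]

lemma tripleCoeff_succ {L : ℝ} (hL : L < 0) (n : ℕ) (j : ℤ) :
    tripleCoeff L (n + 1) j = (1 + exp L ^ (2 * n + 1)) * tripleCoeff L n j -
      exp L ^ (n + 1) * tripleCoeff L n (j - 1) - exp L ^ n * tripleCoeff L n (j + 1) := by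
  unfold tripleCoeff
  have hp := (exp_pos L).ne'
  set p := exp L with hpdef
  have a1 := one_sub_zpow_mul_qPochInv hL (n + 1 - j)
  have a2 := one_sub_zpow_mul_qPochInv hL (n - j)
  have b1 := one_sub_zpow_mul_qPochInv hL (n + 1 + j)
  have b2 := one_sub_zpow_mul_qPochInv hL (n + j)
  rw [← hpdef] at a1 a2 b1 b2
  rw [show (n : ℤ) + 1 - j - 1 = n - j by ring] at a1
  rw [show (n : ℤ) + 1 + j - 1 = n + j by ring] at b1
  rw [show ((n + 1 : ℕ) : ℤ) - j = n + 1 - j by push_cast; ring,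
    show ((n + 1 : ℕ) : ℤ) + j = n + 1 + j by push_cast; ring,
    show (n : ℤ) - (j - 1) = n + 1 - j by ring, show (n : ℤ) + (j - 1) = n + j - 1 by ring,
    show (n : ℤ) - (j + 1) = n - j - 1 by ring, show (n : ℤ) + (j + 1) = n + 1 + j by ring,
    ← a2, ← b2, ← a1, ← b1, zpow_sub_one₀ (by norm_num), zpow_add_one₀ (by norm_num),
    show 2 * (n + 1) = 2 * n + 1 + 1 by ring, Finset.prod_range_succ, Finset.prod_range_succ]
  have w1 : exp (L * (((j - 1 : ℤ) : ℝ) * ((j - 1 : ℤ) + 1)) / 2) =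
      exp (L * (j * (j + 1)) / 2) * (p ^ j)⁻¹ := by
    rw [hpdef, exp_zpow_eq, ← exp_neg, ← exp_add]; push_cast; congr 1; ring
  have w2 : exp (L * (((j + 1 : ℤ) : ℝ) * ((j + 1 : ℤ) + 1)) / 2) =
      exp (L * (j * (j + 1)) / 2) * (p ^ j * p) := by
    rw [hpdef, exp_zpow_eq, ← exp_add, ← exp_add]; push_cast; congr 1; ring
  have c1 : p ^ ((n : ℤ) - j) = p ^ n * (p ^ j)⁻¹ := by
    rw [zpow_sub₀ hp, zpow_natCast, div_eq_mul_inv]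
  have c2 : p ^ ((n : ℤ) + 1 - j) = p ^ n * p * (p ^ j)⁻¹ := by
    rw [zpow_sub₀ hp, zpow_add_one₀ hp, zpow_natCast, div_eq_mul_inv]
  have c3 : p ^ ((n : ℤ) + j) = p ^ n * p ^ j := by rw [zpow_add₀ hp, zpow_natCast]
  have c4 : p ^ ((n : ℤ) + 1 + j) = p ^ n * p * p ^ j := by
    rw [zpow_add₀ hp, zpow_add_one₀ hp, zpow_natCast]
  rw [w1, w2, c1, c2, c3, c4]
  clear a1 a2 b1 b2 w1 w2 c1 c2 c3 c4
  have hY : p ^ j ≠ 0 := zpow_ne_zero _ hp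
  generalize p ^ j = Y at *
  have hX : p ^ n ≠ 0 := pow_ne_zero _ hp
  rw [show p ^ (2 * n + 1 + 1) = (p ^ n) ^ 2 * p ^ 2 by ring,
    show p ^ (2 * n + 1) = (p ^ n) ^ 2 * p by ring, show p ^ (n + 1) = p ^ n * p by ring]
  generalize p ^ n = X at *
  generalize qPochInv L (n + 1 - j) = A at *
  generalize qPochInv L (n + 1 + j) = B at *
  field_simp
  ring

lemma hasSum_tripleCoeff {L : ℝ} (hL : L < 0) (n : ℕ) {z : ℝ} (hz : z ≠ 0) :
    HasSum (fun j : ℤ => tripleCoeff L n j * z ^ j)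
      (∏ k ∈ Finset.range n, (1 - exp L ^ (k + 1) * z) * (1 - exp L ^ k / z)) := by
  induction n with
  | zero =>
    simp only [tripleCoeff_zero, Finset.range_zero, Finset.prod_empty]
    convert! hasSum_ite_eq (0 : ℤ) (1 : ℝ) using 2 with j
    split_ifs with h <;> simp [h]
  | succ n ih =>
    have h1 := (Equiv.subRight (1 : ℤ)).hasSum_iff.mpr ih
    have h2 := (Equiv.addRight (1 : ℤ)).hasSum_iff.mpr ih
    convert! ((ih.mul_left (1 + exp L ^ (2 * n + 1))).sub
      (h1.mul_left (exp L ^ (n + 1) * z))).sub (h2.mul_left (exp L ^ n * z⁻¹)) using 1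
    · funext j
      rw [tripleCoeff_succ hL]
      simp only [Function.comp_apply, Equiv.subRight_apply, Equiv.coe_addRight]
      rw [zpow_sub_one₀ hz, zpow_add_one₀ hz]
      field_simp
    · rw [Finset.prod_range_succ]
      generalize (∏ k ∈ Finset.range n, (_ : ℝ)) = P
      field_simp
      ring

lemma hasSum_mul_tripleCoeff {L : ℝ} (hL : L < 0) (n : ℕ) :
    HasSum (fun j : ℤ => j * tripleCoeff L (n + 1) j)
      ((∏ k ∈ Finset.range (n + 1), (1 - exp L ^ (k + 1))) *
        ∏ k ∈ Finset.range n, (1 - exp L ^ (k + 1))) := by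
  have hs (n : ℕ) := hasSum_tripleCoeff hL n one_ne_zero
  simp only [one_zpow, mul_one, div_one] at hs
  have step (n : ℕ) (W : ℝ) (hW : HasSum (fun j : ℤ => j * tripleCoeff L n j) W) :
      HasSum (fun j : ℤ => j * tripleCoeff L (n + 1) j)
        ((1 - exp L ^ n) * (1 - exp L ^ (n + 1)) * W + exp L ^ n * (1 - exp L) *
          ∏ k ∈ Finset.range n, (1 - exp L ^ (k + 1)) * (1 - exp L ^ k)) := by
    have h1 := (Equiv.subRight (1 : ℤ)).hasSum_iff.mpr (hW.add (hs n))
    have h2 := (Equiv.addRight (1 : ℤ)).hasSum_iff.mpr (hW.sub (hs n))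
    convert! ((hW.mul_left (1 + exp L ^ (2 * n + 1))).sub
      (h1.mul_left (exp L ^ (n + 1)))).sub (h2.mul_left (exp L ^ n)) using 1
    · funext j
      rw [tripleCoeff_succ hL]
      simp only [Function.comp_apply, Equiv.subRight_apply, Equiv.coe_addRight]
      push_cast
      ring
    · ring
  induction n with
  | zero =>
    convert! step 0 0 ?_ using 1
    · simp
    · convert! hasSum_zero (α := ℝ) (β := ℤ) using 1
      funext j
      rw [tripleCoeff_zero]
      split_ifs with h <;> simp [h]
  | succ n ih =>
    convert! step (n + 1) _ ih using 1
    rw [Finset.prod_range_succ' (fun k => (1 - exp L ^ (k + 1)) * (1 - exp L ^ k))]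
    rw [Finset.prod_range_succ _ (n + 1), Finset.prod_range_succ _ n]
    simp only [pow_zero]
    ring

lemma tendsto_tsum_tripleCoeff {L : ℝ} (hL : L < 0) (i : ℕ) (t : ℝ) :
    Tendsto (fun n => ∑' j : ℤ, tripleCoeff L n j * (j + 1 / 2) ^ i * exp (t * (j + 1 / 2))) atTop
      (𝓝 (oddTheta i L t * exp (-L / 8) / eulerF (exp L))) := by
  have hE := eulerF_pos (exp_pos L) (exp_lt_one_iff.mpr hL)
  have hw (j : ℤ) : exp (L * ((j : ℝ) * (j + 1)) / 2) * exp (t * (j + 1 / 2)) =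
      exp (-L / 8) * exp (L * (j + 1 / 2) ^ 2 / 2 + t * (j + 1 / 2)) := by
    rw [← exp_add, ← exp_add]; congr 1; ring
  have hlim : oddTheta i L t * exp (-L / 8) / eulerF (exp L) =
      ∑' j : ℤ, (-1) ^ j * exp (L * (j * (j + 1)) / 2) * eulerF (exp L) * (eulerF (exp L))⁻¹ *
        (eulerF (exp L))⁻¹ * (j + 1 / 2) ^ i * exp (t * (j + 1 / 2)) := by
    rw [oddTheta, thetaSeries, mul_div_assoc, ← tsum_mul_right]
    refine tsum_congr fun j => ?_
    rw [mul_assoc ((-1 : ℝ) ^ j * (j + 1 / 2) ^ i), ← mul_div_assoc, mul_comm (exp _) (exp _), ← hw]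
    field_simp
  rw [hlim]
  refine tendsto_tsum_of_dominated_convergence (bound := fun j : ℤ =>
    (exp (-L / 8) * ((eulerF (exp L))⁻¹ * (eulerF (exp L))⁻¹)) * (|(j : ℝ) + 1 / 2| ^ i *
      exp (L * (j + 1 / 2) ^ 2 / 2 + t * (j + 1 / 2))))
    ((summable_pow_mul_exp_quadratic (1 / 2) i hL t).mul_left _) (fun j => ?_)
    (Eventually.of_forall fun n j => ?_)
  · have c : Tendsto (fun n : ℕ => (n : ℤ)) atTop atTop := tendsto_natCast_atTop_atTop
    have c1 := (tendsto_qPochInv hL).comp (tendsto_atTop_add_const_right _ (-j) c)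
    have c2 := (tendsto_qPochInv hL).comp (tendsto_atTop_add_const_right _ j c)
    have c3 := (tendsto_prod_eulerF (exp_pos L) (exp_lt_one_iff.mpr hL)).comp
      (tendsto_id.const_mul_atTop' (show 0 < 2 by norm_num))
    exact ((((c3.const_mul ((-1 : ℝ) ^ j * exp (L * (j * (j + 1)) / 2))).mul c1).mul c2).mul_const
      _).mul_const _
  · have h1 := abs_neg_one_zpow_le j
    have h2 := abs_qPochInv_le hL (n - j)
    have h3 := abs_qPochInv_le hL (n + j)
    have h4 : |∏ k ∈ Finset.range (2 * n), (1 - exp L ^ (k + 1))| ≤ 1 := by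
      rw [abs_of_nonneg (hE.le.trans (eulerF_le_prod (exp_pos L) (exp_lt_one_iff.mpr hL) _))]
      simpa using prod_one_sub_pow_antitone (exp_pos L) (exp_lt_one_iff.mpr hL) (Nat.zero_le (2 * n))
    unfold tripleCoeff
    rw [Real.norm_eq_abs]
    simp only [abs_mul, abs_exp, abs_pow]
    calc _ ≤ 1 * exp (L * (j * (j + 1)) / 2) * 1 * (eulerF (exp L))⁻¹ * (eulerF (exp L))⁻¹ *
          |(j : ℝ) + 1 / 2| ^ i * exp (t * (j + 1 / 2)) := by gcongr
      _ = (eulerF (exp L))⁻¹ * (eulerF (exp L))⁻¹ * |(j : ℝ) + 1 / 2| ^ i *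
          (exp (L * (j * (j + 1)) / 2) * exp (t * (j + 1 / 2))) := by ring
      _ = _ := by rw [hw]; ring

/-- The Jacobi triple product. -/
lemma tendsto_prod_oddTheta {L : ℝ} (hL : L < 0) (t : ℝ) :
    Tendsto (fun n => exp (L / 8 + t / 2) * eulerF (exp L) * ∏ k ∈ Finset.range n,
      (1 - exp L ^ (k + 1) * exp t) * (1 - exp L ^ k / exp t)) atTop (𝓝 (oddTheta 0 L t)) := by
  have hE := eulerF_pos (exp_pos L) (exp_lt_one_iff.mpr hL)
  have h := (tendsto_tsum_tripleCoeff hL 0 t).const_mul (exp (L / 8) * eulerF (exp L))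
  rw [show exp (L / 8) * eulerF (exp L) * (oddTheta 0 L t * exp (-L / 8) / eulerF (exp L)) =
    oddTheta 0 L t by
      rw [neg_div, exp_neg]; field_simp] at h
  refine h.congr fun n => ?_
  have := ((hasSum_tripleCoeff hL n (exp_pos t).ne').mul_left (exp (t / 2))).tsum_eq
  rw [exp_add, mul_assoc, mul_assoc, mul_assoc, mul_left_comm (exp (t / 2)), ← this]
  congr 2
  refine tsum_congr fun j => ?_
  rw [exp_zpow_eq, mul_left_comm, ← exp_add, pow_zero, mul_one]
  congr 2
  ring

/-- Jacobi's identity for the cube of Euler's product. -/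
lemma oddTheta_one_zero {L : ℝ} (hL : L < 0) :
    oddTheta 1 L 0 = exp (L / 8) * eulerF (exp L) ^ 3 := by
  have hE := eulerF_pos (exp_pos L) (exp_lt_one_iff.mpr hL)
  have h := (tendsto_tsum_tripleCoeff hL 1 0).comp (tendsto_add_atTop_nat 1)
  have hp := tendsto_prod_eulerF (exp_pos L) (exp_lt_one_iff.mpr hL)
  have h2 := (hp.comp (tendsto_add_atTop_nat 1)).mul hp
  have := tendsto_nhds_unique (h.congr fun n => ?_) h2
  · rw [neg_div, exp_neg] at this
    field_simp at this
    linarith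
  · have h0 := hasSum_tripleCoeff hL (n + 1) one_ne_zero
    rw [Finset.prod_range_succ'] at h0
    simp only [pow_zero, div_one, sub_self, mul_zero, one_zpow, mul_one] at h0
    have := ((hasSum_mul_tripleCoeff hL n).add (h0.mul_left (1 / 2))).tsum_eq
    rw [mul_zero, add_zero] at this
    rw [Function.comp_apply, Function.comp_apply, ← this]
    refine tsum_congr fun j => ?_
    rw [zero_mul, exp_zero]
    ring

lemma oddTheta_five_normalized {l : ℝ} (hl : l < 0) (h1 : oddTheta 0 (5 * l) l ≠ 0)
    (h2 : oddTheta 0 (5 * l) (2 * l) ≠ 0) (h0 : oddTheta 1 (5 * l) 0 ≠ 0) {Z₁ Z₂ A₁ A₂ K : ℝ}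
    (hZ₁ : oddTheta 1 (5 * l) l = Z₁ * oddTheta 0 (5 * l) l)
    (hA₁ : oddTheta 2 (5 * l) l = A₁ * oddTheta 0 (5 * l) l)
    (hZ₂ : oddTheta 1 (5 * l) (2 * l) = Z₂ * oddTheta 0 (5 * l) (2 * l))
    (hA₂ : oddTheta 2 (5 * l) (2 * l) = A₂ * oddTheta 0 (5 * l) (2 * l))
    (hK : oddTheta 3 (5 * l) 0 = K * oddTheta 1 (5 * l) 0) :
    2 * Z₁ ^ 2 + 2 * A₁ - 4 * Z₁ * Z₂ + A₂ = K ∧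
    2 * Z₂ ^ 2 + 2 * A₂ + 4 * Z₂ * (1 + Z₁) + 1 + 2 * Z₁ + A₁ = K ∧
    3 * Z₁ + Z₂ + 1 = oddTheta 1 (5 * l) 0 * exp (l / 2) * oddTheta 0 (5 * l) (2 * l) ^ 2 /
      oddTheta 0 (5 * l) l ^ 3 ∧
    3 * Z₂ - Z₁ + 1 = -(oddTheta 1 (5 * l) 0 * exp (-l) * oddTheta 0 (5 * l) l ^ 2 /
      oddTheta 0 (5 * l) (2 * l) ^ 3) := by
  have hL : 5 * l < 0 := by linarith
  have d1 := oddTheta_duplication hL l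
  have d2 := oddTheta_duplication hL (2 * l)
  have t1 := oddTheta_triplication hL l
  have t2 := oddTheta_triplication hL (2 * l)
  rw [show 2 * (2 * l) = 5 * l - l by ring, oddTheta_zero_sub, oddTheta_one_sub hL,
    oddTheta_two_sub hL, hZ₁, hZ₂, hA₁, hA₂, hK] at d2
  rw [show 3 * l = 5 * l - 2 * l by ring, oddTheta_zero_sub, oddTheta_one_sub hL, hZ₁, hZ₂,
    show -(5 * l) / 2 + 2 * l = -(l / 2) by ring, exp_neg] at t1
  rw [show 3 * (2 * l) = 5 * l - -l by ring, show 2 * (2 * l) = 5 * l - l by ring,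
    oddTheta_zero_sub, oddTheta_one_sub hL, oddTheta_neg, oddTheta_neg, oddTheta_zero_sub, hZ₁, hZ₂,
    mul_pow, ← exp_nat_mul, show exp ((3 : ℕ) * (-(5 * l) / 2 + l)) = exp (-(5 * l) / 2 + -l) * exp (-l) by
      rw [← exp_add]; push_cast; congr 1; ring] at t2
  rw [hZ₁, hZ₂, hA₁, hA₂, hK] at d1
  have e4 := exp_pos (-(5 * l) / 2 + l)
  have e6 := exp_pos (-(5 * l) / 2 + -l)
  have e := exp_pos (l / 2)
  generalize exp (-(5 * l) / 2 + l) = a at *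
  generalize exp (-(5 * l) / 2 + -l) = b at *
  generalize exp (l / 2) = c at *
  generalize exp (-l) = d at *
  generalize oddTheta 0 (5 * l) l = s at *
  generalize oddTheta 0 (5 * l) (2 * l) = w at *
  generalize oddTheta 1 (5 * l) 0 = σ at *
  refine ⟨?_, ?_, ?_, ?_⟩
  · refine mul_left_cancel₀ (mul_ne_zero h0 (mul_ne_zero (pow_ne_zero 2 h1) h2)) ?_
    linear_combination d1
  · refine mul_left_cancel₀ (mul_ne_zero h0 (mul_ne_zero (pow_ne_zero 2 h2)
      (mul_ne_zero e4.ne' h1))) ?_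
    linear_combination d2
  · have := e.ne'
    field_simp at t1 ⊢
    linear_combination t1
  · have := e6.ne'
    rw [← neg_div, eq_div_iff (pow_ne_zero 3 h2)]
    refine mul_left_cancel₀ (mul_ne_zero e6.ne' h1) ?_
    linear_combination -t2

/-- The derivative of the fifth power of the Rogers--Ramanujan continued fraction, in theta form. -/
lemma hasDerivAt_oddTheta_five {l : ℝ} (hl : l < 0) (h1 : oddTheta 0 (5 * l) l ≠ 0)
    (h2 : oddTheta 0 (5 * l) (2 * l) ≠ 0) (h0 : oddTheta 1 (5 * l) 0 ≠ 0) :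
    HasDerivAt
      (fun l => exp (-(3 / 2) * l) * (oddTheta 0 (5 * l) l / oddTheta 0 (5 * l) (2 * l)) ^ 5)
      (oddTheta 1 (5 * l) 0 ^ 2 * exp (-l / 2) / (oddTheta 0 (5 * l) l * oddTheta 0 (5 * l) (2 * l)) *
        (1 - 11 * (exp (-(3 / 2) * l) * (oddTheta 0 (5 * l) l / oddTheta 0 (5 * l) (2 * l)) ^ 5) -
          (exp (-(3 / 2) * l) * (oddTheta 0 (5 * l) l / oddTheta 0 (5 * l) (2 * l)) ^ 5) ^ 2)) l ∧
    HasDerivAt (fun l => exp (3 * l) * (oddTheta 0 (5 * l) l * oddTheta 0 (5 * l) (2 * l)) ^ 6 /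
        oddTheta 1 (5 * l) 0 ^ 4)
      (-(oddTheta 1 (5 * l) 0 ^ 2 * exp (-l / 2) /
          (oddTheta 0 (5 * l) l * oddTheta 0 (5 * l) (2 * l))) *
        ((exp (-(3 / 2) * l) * (oddTheta 0 (5 * l) l / oddTheta 0 (5 * l) (2 * l)) ^ 5)⁻¹ +
          exp (-(3 / 2) * l) * (oddTheta 0 (5 * l) l / oddTheta 0 (5 * l) (2 * l)) ^ 5) *
        (exp (3 * l) * (oddTheta 0 (5 * l) l * oddTheta 0 (5 * l) (2 * l)) ^ 6 /
          oddTheta 1 (5 * l) 0 ^ 4)) l := by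
  have hL : 0 + 5 * l < 0 := by linarith
  have D1 := hasDerivAt_oddTheta_comp 0 0 5 0 1 l hL
  have D2 := hasDerivAt_oddTheta_comp 0 0 5 0 2 l hL
  have D0 := hasDerivAt_oddTheta_comp 1 0 5 0 0 l hL
  simp only [zero_add, one_mul, zero_mul, add_zero, Nat.reduceAdd] at D1 D2 D0
  obtain ⟨g1, g2, g3, g4⟩ := oddTheta_five_normalized hl h1 h2 h0
    (div_mul_cancel₀ _ h1).symm (div_mul_cancel₀ _ h1).symm (div_mul_cancel₀ _ h2).symm
    (div_mul_cancel₀ _ h2).symm (div_mul_cancel₀ _ h0).symm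
  have hexp (c : ℝ) : HasDerivAt (fun l => exp (c * l)) (c * exp (c * l)) l :=
    (((hasDerivAt_id l).const_mul c).exp).congr_deriv (by simp; ring)
  have E1 : exp (-(3 / 2) * l) = exp (-l) / exp (l / 2) := by
    rw [← exp_sub]; congr 1; ring
  have E2 : exp (-l / 2) = (exp (l / 2))⁻¹ := by rw [← exp_neg]; congr 1; ring
  have E3 : exp (-l) = (exp (l / 2) ^ 2)⁻¹ := by
    rw [← exp_nat_mul, ← exp_neg]; congr 1; push_cast; ring
  have e := (exp_pos (l / 2)).ne'
  rw [E3] at g4 E1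
  rw [E1, E2]
  have hB : oddTheta 1 (5 * l) 0 ^ 2 * (exp (l / 2))⁻¹ /
      (oddTheta 0 (5 * l) l * oddTheta 0 (5 * l) (2 * l)) =
      -(3 * (oddTheta 1 (5 * l) l / oddTheta 0 (5 * l) l) +
        oddTheta 1 (5 * l) (2 * l) / oddTheta 0 (5 * l) (2 * l) + 1) *
      (3 * (oddTheta 1 (5 * l) (2 * l) / oddTheta 0 (5 * l) (2 * l)) -
        oddTheta 1 (5 * l) l / oddTheta 0 (5 * l) l + 1) := by
    rw [g3, g4]
    field_simp
  have hr : (exp (l / 2) ^ 2)⁻¹ / exp (l / 2) *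
      (oddTheta 0 (5 * l) l / oddTheta 0 (5 * l) (2 * l)) ^ 5 *
      (3 * (oddTheta 1 (5 * l) l / oddTheta 0 (5 * l) l) +
        oddTheta 1 (5 * l) (2 * l) / oddTheta 0 (5 * l) (2 * l) + 1) =
      -(3 * (oddTheta 1 (5 * l) (2 * l) / oddTheta 0 (5 * l) (2 * l)) -
        oddTheta 1 (5 * l) l / oddTheta 0 (5 * l) l + 1) := by
    rw [g3, g4]
    field_simp
  have hr0 : (exp (l / 2) ^ 2)⁻¹ / exp (l / 2) *
      (oddTheta 0 (5 * l) l / oddTheta 0 (5 * l) (2 * l)) ^ 5 ≠ 0 := by positivity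
  clear g3 g4
  constructor
  · refine ((hexp _).mul ((D1.div D2 h2).pow 5)).congr_deriv ?_
    rw [E1, hB]
    trans (exp (l / 2) ^ 2)⁻¹ / exp (l / 2) *
      (oddTheta 0 (5 * l) l / oddTheta 0 (5 * l) (2 * l)) ^ 5 *
      (-(3 / 2) + 5 * (5 / 2 * (oddTheta 2 (5 * l) l / oddTheta 0 (5 * l) l) +
        oddTheta 1 (5 * l) l / oddTheta 0 (5 * l) l -
        5 / 2 * (oddTheta 2 (5 * l) (2 * l) / oddTheta 0 (5 * l) (2 * l)) -
        2 * (oddTheta 1 (5 * l) (2 * l) / oddTheta 0 (5 * l) (2 * l))))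
    · simp only [Pi.div_apply, Pi.pow_apply, Nat.reduceSub, Nat.cast_ofNat]
      clear hB hr hr0 g1 g2 D1 D2 D0
      generalize oddTheta 0 (5 * l) l = s at *
      generalize oddTheta 0 (5 * l) (2 * l) = w at *
      generalize oddTheta 1 (5 * l) 0 = σ at *
      generalize exp (l / 2) = c at *
      field_simp
      ring
    clear hB D1 D2 D0 hexp
    generalize (exp (l / 2) ^ 2)⁻¹ / exp (l / 2) *
      (oddTheta 0 (5 * l) l / oddTheta 0 (5 * l) (2 * l)) ^ 5 = r at *
    generalize oddTheta 1 (5 * l) l / oddTheta 0 (5 * l) l = Z₁ at *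
    generalize oddTheta 1 (5 * l) (2 * l) / oddTheta 0 (5 * l) (2 * l) = Z₂ at *
    generalize oddTheta 2 (5 * l) l / oddTheta 0 (5 * l) l = A₁ at *
    generalize oddTheta 2 (5 * l) (2 * l) / oddTheta 0 (5 * l) (2 * l) = A₂ at *
    linear_combination ((3 * Z₁ + Z₂ + 1) - r * (3 * Z₂ - Z₁ + 1)) * hr +
      25 / 2 * r * (g1 - g2)
  · refine (((hexp _).mul ((D1.mul D2).pow 6)).div (D0.pow 4) (pow_ne_zero 4 h0)).congr_deriv ?_
    rw [hB]
    trans (3 + 15 * (oddTheta 2 (5 * l) l / oddTheta 0 (5 * l) l +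
        oddTheta 2 (5 * l) (2 * l) / oddTheta 0 (5 * l) (2 * l)) +
        6 * (oddTheta 1 (5 * l) l / oddTheta 0 (5 * l) l) +
        12 * (oddTheta 1 (5 * l) (2 * l) / oddTheta 0 (5 * l) (2 * l)) -
        10 * (oddTheta 3 (5 * l) 0 / oddTheta 1 (5 * l) 0)) *
        (exp (3 * l) * (oddTheta 0 (5 * l) l * oddTheta 0 (5 * l) (2 * l)) ^ 6 /
          oddTheta 1 (5 * l) 0 ^ 4)
    · simp only [Pi.mul_apply, Pi.pow_apply, Nat.reduceSub, Nat.cast_ofNat]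
      clear hB hr hr0 g1 g2 D1 D2 D0
      generalize oddTheta 0 (5 * l) l = s at *
      generalize oddTheta 0 (5 * l) (2 * l) = w at *
      generalize oddTheta 1 (5 * l) 0 = σ at *
      generalize exp (l / 2) = c at *
      field_simp
      ring
    congr 1
    clear hB D1 D2 D0 hexp
    generalize (exp (l / 2) ^ 2)⁻¹ / exp (l / 2) *
      (oddTheta 0 (5 * l) l / oddTheta 0 (5 * l) (2 * l)) ^ 5 = r at *
    generalize oddTheta 1 (5 * l) l / oddTheta 0 (5 * l) l = Z₁ at *
    generalize oddTheta 1 (5 * l) (2 * l) / oddTheta 0 (5 * l) (2 * l) = Z₂ at *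
    generalize oddTheta 2 (5 * l) l / oddTheta 0 (5 * l) l = A₁ at *
    generalize oddTheta 2 (5 * l) (2 * l) / oddTheta 0 (5 * l) (2 * l) = A₂ at *
    generalize oddTheta 3 (5 * l) 0 / oddTheta 1 (5 * l) 0 = K at *
    field_simp
    linear_combination 5 * r * (g1 + g2) - ((3 * Z₁ + Z₂ + 1) + r * (3 * Z₂ - Z₁ + 1)) * hr

lemma prod_range_five_mul (f : ℕ → ℝ) (n : ℕ) : ∏ k ∈ Finset.range (5 * n), f k =
    (∏ k ∈ Finset.range n, f (5 * k + 4)) * (∏ k ∈ Finset.range n, f (5 * k + 3) * f (5 * k)) *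
      ∏ k ∈ Finset.range n, f (5 * k + 2) * f (5 * k + 1) := by
  induction n with
  | zero => simp
  | succ n ih =>
    rw [show 5 * (n + 1) = 5 * n + 1 + 1 + 1 + 1 + 1 by ring]
    simp only [Finset.prod_range_succ, ih]
    ring

/-- Dissection of Euler's product modulo `5`; the factors `G` and `H` are the reciprocals of the
Rogers--Ramanujan functions. -/
lemma exists_eulerF_dissection {l : ℝ} (hl : l < 0) : ∃ G H : ℝ,
    (eulerF (exp l) ≤ G ∧ G ≤ 1) ∧ (eulerF (exp l) ≤ H ∧ H ≤ 1) ∧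
    oddTheta 0 (5 * l) l = -(exp (l / 8) * eulerF (exp l ^ 5) * G) ∧
    oddTheta 0 (5 * l) (2 * l) = -(exp (-(3 / 8) * l) * eulerF (exp l ^ 5) * H) ∧
    eulerF (exp l) = eulerF (exp l ^ 5) * G * H := by
  have hL : 5 * l < 0 := by linarith
  have hq0 := exp_pos l
  have hq1 : exp l < 1 := exp_lt_one_iff.mpr hl
  have hp : exp (5 * l) = exp l ^ 5 := by rw [← exp_nat_mul]; norm_num
  have h50 : 0 < exp l ^ 5 := pow_pos hq0 5
  have h51 : exp l ^ 5 < 1 := pow_lt_one₀ hq0.le hq1 (by norm_num)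
  have hE := eulerF_pos h50 h51
  have hF := eulerF_pos hq0 hq1
  have hle (n : ℕ) : 0 ≤ 1 - exp l ^ (n + 1) ∧ 1 - exp l ^ (n + 1) ≤ 1 := by
    have := pow_lt_one₀ hq0.le hq1 (by omega : n + 1 ≠ 0)
    have := pow_pos hq0 (n + 1)
    constructor <;> linarith
  have key (i j : ℕ) (hij : i + j = 3) (t : ℝ) (ht : t = (i + 1) * l) : ∃ G : ℝ, 0 ≤ G ∧ G ≤ 1 ∧
      oddTheta 0 (5 * l) t = -(exp (5 * l / 8 - t / 2) * eulerF (exp l ^ 5) * G) ∧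
      Tendsto (fun n => ∏ k ∈ Finset.range n,
        (1 - exp l ^ (5 * k + j + 1)) * (1 - exp l ^ (5 * k + i + 1))) atTop (𝓝 G) := by
    have h := (tendsto_prod_oddTheta hL (-t)).div_const (exp (5 * l / 8 - t / 2) * eulerF (exp l ^ 5))
    have hc : exp (5 * l / 8 - t / 2) * eulerF (exp l ^ 5) ≠ 0 := by positivity
    have e1 (k : ℕ) : (exp l ^ 5) ^ (k + 1) * exp (-t) = exp l ^ (5 * k + j + 1) := by
      have : (i : ℝ) + j = 3 := by exact_mod_cast hij
      rw [← pow_mul, ← exp_nat_mul, ← exp_nat_mul, ← exp_add, ht]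
      congr 1
      push_cast
      linear_combination -l * this
    have e2 (k : ℕ) : (exp l ^ 5) ^ k / exp (-t) = exp l ^ (5 * k + i + 1) := by
      rw [← pow_mul, ← exp_nat_mul, ← exp_nat_mul, ← exp_sub, ht]
      congr 1
      push_cast
      ring
    simp only [hp, e1, e2, neg_div, ← sub_eq_add_neg, mul_div_cancel_left₀ _ hc] at h
    refine ⟨_, ge_of_tendsto' h fun n => Finset.prod_nonneg fun k _ =>
      mul_nonneg (hle _).1 (hle _).1, le_of_tendsto' h fun n => Finset.prod_le_one (fun k _ =>
      mul_nonneg (hle _).1 (hle _).1) fun k _ => mul_le_one₀ (hle _).2 (hle _).1 (hle _).2, ?_, h⟩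
    rw [mul_div_cancel₀ _ hc, oddTheta_neg]
    ring
  obtain ⟨G, hG0, hG1, hG, tG⟩ := key 0 3 rfl l (by simp)
  obtain ⟨H, hH0, hH1, hH, tH⟩ := key 1 2 rfl (2 * l) (by push_cast; ring)
  have hprod : eulerF (exp l) = eulerF (exp l ^ 5) * G * H := by
    refine tendsto_nhds_unique ((tendsto_prod_eulerF hq0 hq1).comp
      (tendsto_id.const_mul_atTop' (show 0 < 5 by norm_num))) ?_
    refine (((tendsto_prod_eulerF h50 h51).mul tG).mul tH).congr fun n => ?_
    rw [Function.comp_apply, id, prod_range_five_mul (fun k => 1 - exp l ^ (k + 1))]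
    simp only [← pow_mul]
    rfl
  have hE1 := eulerF_le_one h50 h51
  refine ⟨G, H, ⟨?_, hG1⟩, ⟨?_, hH1⟩, ?_, ?_, hprod⟩
  · rw [hprod]
    calc _ ≤ 1 * G * 1 := by gcongr
      _ = G := by ring
  · rw [hprod]
    calc _ ≤ 1 * 1 * H := by gcongr
      _ = H := by ring
  · rw [hG]; congr 4; ring
  · rw [hH]; congr 4; ring

/-- Ramanujan's identity `1 / R⁵ - 11 - R⁵ = f(-q)⁶ / (q f(-q⁵)⁶)`, with the derivative of both
sides. -/
lemma hasDerivAt_uF_exp {l : ℝ} (hl : l < 0) : HasDerivAt (fun l => uF (exp l))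
    (-(exp l * eulerF (exp l ^ 5) ^ 5 / eulerF (exp l)) * √((uF (exp l) + 11) ^ 2 + 4) *
      uF (exp l)) l := by
  set R : ℝ → ℝ := fun l =>
    exp (-(3 / 2) * l) * (oddTheta 0 (5 * l) l / oddTheta 0 (5 * l) (2 * l)) ^ 5 with hR
  have facts {l : ℝ} (hl : l < 0) : 0 < R l ∧ 0 < uF (exp l) ∧
      HasDerivAt R (exp l * eulerF (exp l ^ 5) ^ 5 / eulerF (exp l) *
        (1 - 11 * R l - R l ^ 2)) l ∧
      HasDerivAt (fun l => uF (exp l)) (-(exp l * eulerF (exp l ^ 5) ^ 5 / eulerF (exp l)) *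
        ((R l)⁻¹ + R l) * uF (exp l)) l ∧
      exp l * eulerF (exp l) ^ 5 ≤ R l ∧ R l * eulerF (exp l) ^ 5 ≤ exp l := by
    have val {l : ℝ} (hl : l < 0) : 0 < uF (exp l) ∧ oddTheta 0 (5 * l) l ≠ 0 ∧
        oddTheta 0 (5 * l) (2 * l) ≠ 0 ∧ oddTheta 1 (5 * l) 0 ≠ 0 ∧
        uF (exp l) = exp (3 * l) * (oddTheta 0 (5 * l) l * oddTheta 0 (5 * l) (2 * l)) ^ 6 /
          oddTheta 1 (5 * l) 0 ^ 4 ∧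
        oddTheta 1 (5 * l) 0 ^ 2 * exp (-l / 2) /
          (oddTheta 0 (5 * l) l * oddTheta 0 (5 * l) (2 * l)) =
            exp l * eulerF (exp l ^ 5) ^ 5 / eulerF (exp l) ∧
        exp l * eulerF (exp l) ^ 5 ≤ R l ∧ R l * eulerF (exp l) ^ 5 ≤ exp l := by
      obtain ⟨G, H, ⟨hG, hG1⟩, ⟨hH, hH1⟩, h1, h2, h3⟩ := exists_eulerF_dissection hl
      have hq0 := exp_pos l
      have hq1 : exp l < 1 := exp_lt_one_iff.mpr hl
      have hF := eulerF_pos hq0 hq1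
      have hE := eulerF_pos (pow_pos hq0 5) (pow_lt_one₀ hq0.le hq1 (by norm_num))
      have h4 := oddTheta_one_zero (show 5 * l < 0 by linarith)
      rw [show exp (5 * l) = exp l ^ 5 by rw [← exp_nat_mul]; norm_num] at h4
      have hG0 := hF.trans_le hG
      have hH0 := hF.trans_le hH
      have e1 : exp (-(3 / 8) * l) = exp (l / 8) / exp (l / 8) ^ 4 := by
        rw [← exp_nat_mul, ← exp_sub]; congr 1; push_cast; ring
      have e2 : exp (5 * l / 8) = exp (l / 8) ^ 5 := by
        rw [← exp_nat_mul]; congr 1; push_cast; ring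
      have e3 : exp (-(3 / 2) * l) = (exp (l / 8) ^ 12)⁻¹ := by
        rw [← exp_nat_mul, ← exp_neg]; congr 1; push_cast; ring
      have e4 : exp (3 * l) = exp (l / 8) ^ 24 := by
        rw [← exp_nat_mul]; congr 1; push_cast; ring
      have e5 : exp (-l / 2) = (exp (l / 8) ^ 4)⁻¹ := by
        rw [← exp_nat_mul, ← exp_neg]; congr 1; push_cast; ring
      have e6 : exp l = exp (l / 8) ^ 8 := by
        rw [← exp_nat_mul]; congr 1; push_cast; ring
      have e := exp_pos (l / 8)
      have hRv : R l = exp l * (G / H) ^ 5 := by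
        simp only [hR]
        rw [h1, h2, e1, e3]
        generalize eulerF (exp l ^ 5) = E at *
        rw [e6]
        field_simp
      have hGH : eulerF (exp l) ≤ G / H := by
        rw [le_div_iff₀ hH0]; nlinarith
      have hHG : G / H * eulerF (exp l) ≤ 1 := by
        rw [div_mul_eq_mul_div, div_le_one hH0]; nlinarith
      refine ⟨by unfold uF; positivity, ?_, ?_, ?_, ?_, ?_, ?_, ?_⟩
      · rw [h1]; exact neg_ne_zero.mpr (by positivity)
      · rw [h2]; exact neg_ne_zero.mpr (by positivity)
      · rw [h4]; positivity
      · rw [h1, h2, h4, uF, e1, e2, e4, h3]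
        generalize eulerF (exp l ^ 5) = E at *
        rw [e6]
        field_simp
      · rw [h1, h2, h4, e1, e2, e5, h3]
        generalize eulerF (exp l ^ 5) = E at *
        rw [e6]
        field_simp
      · rw [hRv]; gcongr
      · rw [hRv, mul_assoc, ← mul_pow]
        exact mul_le_of_le_one_right hq0.le (pow_le_one₀ (by positivity) hHG)
    obtain ⟨c1, c2, c3, c4, c5, c6, c7, c8⟩ := val hl
    obtain ⟨d1, d2⟩ := hasDerivAt_oddTheta_five hl c2 c3 c4
    rw [c6] at d1 d2
    rw [← c5] at d2
    have hF := eulerF_pos (exp_pos l) (exp_lt_one_iff.mpr hl)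
    refine ⟨lt_of_lt_of_le (by positivity) c7, c1, d1, d2.congr_of_eventuallyEq ?_, c7, c8⟩
    filter_upwards [Iio_mem_nhds hl] with x hx
    exact (val hx).2.2.2.2.1
  have hconst {x y : ℝ} (hx : x < 0) (hy : y < 0) :
      ((R x)⁻¹ - 11 - R x) / uF (exp x) = ((R y)⁻¹ - 11 - R y) / uF (exp y) := by
    have hd {l : ℝ} (hl : l < 0) :
        HasDerivAt (fun l => ((R l)⁻¹ - 11 - R l) / uF (exp l)) 0 l := by
      obtain ⟨c1, c2, d1, d2, -, -⟩ := facts hl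
      refine ((((d1.inv c1.ne').sub_const 11).sub d1).div d2 c2.ne').congr_deriv ?_
      simp only [Pi.sub_apply, Pi.inv_apply]
      have := c1.ne'
      generalize exp l * eulerF (exp l ^ 5) ^ 5 / eulerF (exp l) = B
      generalize R l = r at *
      field_simp
      ring
    exact isOpen_Iio.is_const_of_deriv_eq_zero (convex_Iio 0).isPreconnected
      (fun z hz => (hd hz).differentiableAt.differentiableWithinAt) (fun z hz => (hd hz).deriv) hx hy
  have hneg : ∀ᶠ l : ℝ in atBot, l < 0 := eventually_lt_atBot 0
  have hF : Tendsto (fun l => eulerF (exp l)) atBot (𝓝 1) :=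
    tendsto_eulerF_zero.comp tendsto_exp_atBot
  have hE : Tendsto (fun l => eulerF (exp l ^ 5)) atBot (𝓝 1) :=
    tendsto_eulerF_zero.comp (by simpa using tendsto_exp_atBot.pow 5)
  have hF5 : Tendsto (fun l => eulerF (exp l) ^ 5) atBot (𝓝 1) := by simpa using hF.pow 5
  have hF5' : Tendsto (fun l => (eulerF (exp l) ^ 5)⁻¹) atBot (𝓝 1) := by
    simpa using hF5.inv₀ one_ne_zero
  have hF0 {l : ℝ} (hl : l < 0) : 0 < eulerF (exp l) :=
    eulerF_pos (exp_pos l) (exp_lt_one_iff.mpr hl)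
  have hR1 : Tendsto (fun l => exp l * (R l)⁻¹) atBot (𝓝 1) := by
    refine tendsto_of_tendsto_of_tendsto_of_le_of_le' hF5 hF5' ?_ ?_ <;>
    · filter_upwards [hneg] with l hl
      obtain ⟨c1, -, -, -, c2, c3⟩ := facts hl
      have := hF0 hl
      field_simp
      linarith
  have hR2 : Tendsto (fun l => exp l * R l) atBot (𝓝 0) := by
    have h0 : Tendsto (fun l => exp l * exp l * (eulerF (exp l) ^ 5)⁻¹) atBot (𝓝 0) := by
      simpa using (tendsto_exp_atBot.mul tendsto_exp_atBot).mul hF5'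
    refine tendsto_of_tendsto_of_tendsto_of_le_of_le' tendsto_const_nhds h0 ?_ ?_
    · filter_upwards [hneg] with l hl
      exact mul_nonneg (exp_pos l).le (facts hl).1.le
    · filter_upwards [hneg] with l hl
      have := hF0 hl
      rw [mul_assoc, ← div_eq_mul_inv]
      gcongr
      rw [le_div_iff₀ (by positivity)]
      exact (facts hl).2.2.2.2.2
  have hU : Tendsto (fun l => exp l * uF (exp l)) atBot (𝓝 1) := by
    have := (hF.pow 6).div (hE.pow 6) (by norm_num)
    norm_num at this
    refine this.congr fun l => ?_
    have := (exp_pos l).ne'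
    rw [uF, Pi.div_apply]
    field_simp
  have hlim : Tendsto (fun l => ((R l)⁻¹ - 11 - R l) / uF (exp l)) atBot (𝓝 1) := by
    have := ((hR1.sub (tendsto_exp_atBot.const_mul 11)).sub hR2).div hU one_ne_zero
    norm_num at this
    refine this.congr fun l => ?_
    rw [Pi.div_apply, ← mul_div_mul_left ((R l)⁻¹ - 11 - R l) _ (exp_pos l).ne']
    ring
  have hone : ((R l)⁻¹ - 11 - R l) / uF (exp l) = 1 :=
    tendsto_nhds_unique (tendsto_const_nhds.congr' (hneg.mono fun x hx => hconst hl hx)) hlim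
  obtain ⟨c1, c2, -, d, -, -⟩ := facts hl
  rw [div_eq_one_iff_eq c2.ne'] at hone
  have hs : √((uF (exp l) + 11) ^ 2 + 4) = (R l)⁻¹ + R l := by
    rw [sqrt_eq_iff_eq_sq (by positivity) (by positivity), ← hone]
    field_simp
    ring
  rwa [hs]

lemma uF_pos {q : ℝ} (h0 : 0 < q) (h1 : q < 1) : 0 < uF q := by
  have := eulerF_pos h0 h1
  have := eulerF_pos (pow_pos h0 5) (pow_lt_one₀ h0.le h1 (by norm_num))
  unfold uF
  positivity

lemma hasDerivAt_uF {q : ℝ} (h0 : 0 < q) (h1 : q < 1) : HasDerivAt uF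
    (-(eulerF (q ^ 5) ^ 5 / eulerF q * √((uF q + 11) ^ 2 + 4) * uF q)) q := by
  have h := (hasDerivAt_uF_exp (log_neg h0 h1)).comp q (hasDerivAt_log h0.ne')
  rw [exp_log h0] at h
  refine (h.congr_of_eventuallyEq ?_).congr_deriv ?_
  · filter_upwards [lt_mem_nhds h0] with x hx
    rw [Function.comp_apply, exp_log hx]
  · field_simp

lemma deriv_uF_neg {q : ℝ} (h0 : 0 < q) (h1 : q < 1) :
    -(eulerF (q ^ 5) ^ 5 / eulerF q * √((uF q + 11) ^ 2 + 4) * uF q) < 0 := by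
  have := eulerF_pos h0 h1
  have := eulerF_pos (pow_pos h0 5) (pow_lt_one₀ h0.le h1 (by norm_num))
  have := uF_pos h0 h1
  rw [neg_lt_zero]
  positivity

lemma strictAntiOn_uF : StrictAntiOn uF (Set.Ioo 0 1) := by
  refine strictAntiOn_of_deriv_neg (convex_Ioo 0 1)
    (fun q hq => (hasDerivAt_uF hq.1 hq.2).continuousAt.continuousWithinAt) fun q hq => ?_
  rw [interior_Ioo] at hq
  rw [(hasDerivAt_uF hq.1 hq.2).deriv]
  exact deriv_uF_neg hq.1 hq.2

lemma tendsto_uF_zero : Tendsto uF (𝓝[>] 0) atTop := by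
  have h5 : Tendsto (fun q : ℝ => q ^ 5) (𝓝 0) (𝓝 0) := by
    simpa using (continuous_pow 5).tendsto (0 : ℝ)
  have h := ((tendsto_eulerF_zero.pow 6).div ((tendsto_eulerF_zero.comp h5).pow 6)
    (by norm_num)).mono_left (nhdsWithin_le_nhds (s := Set.Ioi (0 : ℝ)))
  norm_num at h
  refine (tendsto_inv_nhdsGT_zero.atTop_mul_pos one_pos h).congr fun q => ?_
  rw [uF, Pi.div_apply, inv_mul_eq_div, div_div, mul_comm q]

lemma image_uF_Ioo {a : ℝ} (ha : 0 < a) (ha1 : a < 1) : uF '' Set.Ioo 0 a = Set.Ioi (uF a) := by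
  refine subset_antisymm ?_ fun y hy => ?_
  · rintro _ ⟨q, hq, rfl⟩
    exact strictAntiOn_uF ⟨hq.1, hq.2.trans ha1⟩ ⟨ha, ha1⟩ hq.2
  · obtain ⟨b, hb, hb0, hba⟩ := ((tendsto_uF_zero.eventually_gt_atTop y).and
      (Ioo_mem_nhdsGT ha)).exists
    have hc : ContinuousOn uF (Set.Icc b a) := fun q hq =>
      (hasDerivAt_uF (hb0.trans_le hq.1) (hq.2.trans_lt ha1)).continuousAt.continuousWithinAt
    obtain ⟨q, hq, rfl⟩ := intermediate_value_Ioo' hba.le hc ⟨hy, hb⟩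
    exact ⟨q, ⟨hb0.trans hq.1, hq.2⟩, rfl⟩

lemma integrableOn_Ioi_one_div_rpow_mul_sqrt {k : ℝ} (hk : -1 < k) {c : ℝ} (hc : 0 < c) :
    IntegrableOn (fun t : ℝ => 1 / (t ^ (k + 1) * √((t + 11) ^ 2 + 4))) (Set.Ioi c) := by
  refine (integrableOn_Ioi_rpow_of_lt (show -(k + 2) < -1 by linarith) hc).mono' ?_ ?_
  · refine ContinuousOn.aestronglyMeasurable ?_ measurableSet_Ioi
    refine ContinuousOn.div continuousOn_const (ContinuousOn.mul ?_ (by fun_prop)) fun t ht => ?_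
    · exact continuousOn_id.rpow_const fun t ht => Or.inl (hc.trans ht).ne'
    · have : 0 < t := hc.trans ht
      positivity
  · refine (ae_restrict_iff' measurableSet_Ioi).mpr (.of_forall fun t ht => ?_)
    have ht0 : 0 < t := hc.trans ht
    rw [norm_of_nonneg (by positivity), rpow_neg ht0.le, ← one_div,
      show k + 2 = k + 1 + 1 by ring, rpow_add_one ht0.ne' (k + 1)]
    have : t ≤ √((t + 11) ^ 2 + 4) := (le_sqrt' ht0).mpr (by nlinarith)
    gcongr

theorem integral_fk_F (k : ℝ) (hk : -1 < k) (a : ℝ) (ha : 0 < a) (ha1 : a < 1) :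
    IntervalIntegrable
        (fun q => (eulerF (q ^ 5) / eulerF q) ^ (6 * k + 5) * eulerF q ^ 4 * q ^ k)
        volume 0 a ∧
      IntegrableOn
        (fun x => 1 / ((x + uF a) ^ (k + 1) * Real.sqrt ((x + uF a + 11) ^ 2 + 4)))
        (Set.Ioi (0 : ℝ)) ∧
      ∫ q in (0:ℝ)..a, (eulerF (q ^ 5) / eulerF q) ^ (6 * k + 5) * eulerF q ^ 4 * q ^ k =
        ∫ x in Set.Ioi (0 : ℝ),
          1 / ((x + uF a) ^ (k + 1) * Real.sqrt ((x + uF a + 11) ^ 2 + 4)) := by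
  have hu := uF_pos ha ha1
  have hI := integrableOn_Ioi_one_div_rpow_mul_sqrt hk hu
  have hderiv : ∀ q ∈ Set.Ioo 0 a, HasDerivWithinAt uF
      (-(eulerF (q ^ 5) ^ 5 / eulerF q * √((uF q + 11) ^ 2 + 4) * uF q)) (Set.Ioo 0 a) q :=
    fun q hq => (hasDerivAt_uF hq.1 (hq.2.trans ha1)).hasDerivWithinAt
  have hinj : Set.InjOn uF (Set.Ioo 0 a) :=
    strictAntiOn_uF.injOn.mono (Set.Ioo_subset_Ioo_right ha1.le)
  have hfun : Set.EqOn (fun q => |-(eulerF (q ^ 5) ^ 5 / eulerF q *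
      √((uF q + 11) ^ 2 + 4) * uF q)| • (1 / (uF q ^ (k + 1) * √((uF q + 11) ^ 2 + 4))))
      (fun q => (eulerF (q ^ 5) / eulerF q) ^ (6 * k + 5) * eulerF q ^ 4 * q ^ k)
      (Set.Ioo 0 a) := by
    intro q ⟨h0, h2⟩
    have h1 := h2.trans ha1
    have hF := eulerF_pos h0 h1
    have hE := eulerF_pos (pow_pos h0 5) (pow_lt_one₀ h0.le h1 (by norm_num))
    have hU := uF_pos h0 h1
    have hs : 0 < √((uF q + 11) ^ 2 + 4) := by positivity
    have hq : uF q ^ k * ((eulerF (q ^ 5) / eulerF q) ^ (6 * k) * q ^ k) = 1 := by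
      rw [show (6 : ℝ) = (6 : ℕ) by norm_num, rpow_natCast_mul (by positivity),
        ← mul_rpow (by positivity) h0.le, ← mul_rpow hU.le (by positivity), uF]
      convert one_rpow k using 2
      field_simp
    have h5 : (eulerF (q ^ 5) / eulerF q) ^ (6 * k + 5) =
        (eulerF (q ^ 5) / eulerF q) ^ (6 * k) * (eulerF (q ^ 5) / eulerF q) ^ 5 := by
      rw [rpow_add (by positivity)]
      norm_cast
    simp only [smul_eq_mul]
    rw [abs_of_neg (deriv_uF_neg h0 h1), neg_neg, rpow_add_one hU.ne', h5]
    have hk0 : 0 < uF q ^ k := rpow_pos_of_pos hU k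
    trans eulerF (q ^ 5) ^ 5 / eulerF q / uF q ^ k
    · field_simp
    · rw [div_eq_iff hk0.ne']
      trans eulerF (q ^ 5) ^ 5 / eulerF q *
        (uF q ^ k * ((eulerF (q ^ 5) / eulerF q) ^ (6 * k) * q ^ k))
      · rw [hq, mul_one]
      · generalize (eulerF (q ^ 5) / eulerF q) ^ (6 * k) = X
        field_simp
  have hmp := measurePreserving_add_right volume (uF a)
  have hme := measurableEmbedding_addRight (uF a)
  have hpre : (fun x => x + uF a) ⁻¹' Set.Ioi (uF a) = Set.Ioi 0 := by simp
  refine ⟨?_, ?_, ?_⟩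
  · rw [intervalIntegrable_iff_integrableOn_Ioo_of_le ha.le,
      ← integrableOn_congr_fun hfun measurableSet_Ioo]
    refine (integrableOn_image_iff_integrableOn_abs_deriv_smul measurableSet_Ioo hderiv hinj
      (fun t => 1 / (t ^ (k + 1) * √((t + 11) ^ 2 + 4)))).mp ?_
    rwa [image_uF_Ioo ha ha1]
  · have := (hmp.integrableOn_comp_preimage hme).mpr hI
    rwa [hpre] at this
  · rw [intervalIntegral.integral_of_le ha.le, integral_Ioc_eq_integral_Ioo,
      ← setIntegral_congr_fun measurableSet_Ioo hfun,
      ← integral_image_eq_integral_abs_deriv_smul measurableSet_Ioo hderiv hinj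
        (fun t => 1 / (t ^ (k + 1) * √((t + 11) ^ 2 + 4))), image_uF_Ioo ha ha1,
      ← hmp.setIntegral_preimage_emb hme, hpre]
end
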